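/- arXiv:2307.09039 — 5 statements merged into one kernel-verified Lean document; each statement's English description precedes it below -/
import Mathlib

section
/- Let d ≥ 1, T > 0, M ≥ 1, positive integers c_1,…,c_M with c_0 := 1, and let u be the exact solution of the linear ODE and u^n the iterates of the hybrid splitting scheme (Algorithm 3) with time step Δt = T/N. Then the scheme is first-order accurate: there exist a constant C > 0 and N₀ ∈ ℕ such that for all N ≥ N₀ and all 0 ≤ n ≤ N, ‖u^n − u(nΔt)‖ ≤ C·Δt. -/
open Finset

/-- Apply a `d × d` real matrix to a vector of `EuclideanSpace ℝ (Fin d)`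
(so that norms are Euclidean norms). -/
noncomputable def matApp {d : ℕ} (A : Matrix (Fin d) (Fin d) ℝ)
    (v : EuclideanSpace ℝ (Fin d)) : EuclideanSpace ℝ (Fin d) :=
  Matrix.toEuclideanCLM (𝕜 := ℝ) A v

/-- One step of the hybrid splitting scheme (Algorithm 3): starting from `un` at time `tn`
(with `tn1 = tn + Δt`), `hybridSub d c A S f Δt tn tn1 un m` returns the pair consisting of the
substep average `u^{n+m/M}` and the substep channels `k ↦ u^{n+m/M}_k`. -/
noncomputable def hybridSub (d : ℕ) (c : ℕ → ℕ)
    (A : ℕ → ℕ → ℕ → ℝ → Matrix (Fin d) (Fin d) ℝ)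
    (S : ℕ → ℕ → ℝ → Matrix (Fin d) (Fin d) ℝ)
    (f : ℕ → ℕ → ℝ → EuclideanSpace ℝ (Fin d))
    (Δt tn tn1 : ℝ) (un : EuclideanSpace ℝ (Fin d)) :
    ℕ → EuclideanSpace ℝ (Fin d) × (ℕ → EuclideanSpace ℝ (Fin d))
  | 0 => (un, fun _ => un)
  | (m + 1) =>
      let prev := hybridSub d c A S f Δt tn tn1 un m
      let uk : ℕ → EuclideanSpace ℝ (Fin d) := fun k =>
        matApp ((1 + ((c (m + 1) : ℝ) * Δt) • S (m + 1) k tn1)⁻¹)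
          (prev.1 - ((c (m + 1) : ℝ) * Δt) •
            ((∑ s ∈ Finset.Icc 1 (c m), matApp (A (m + 1) k s tn) (prev.2 s))
              + f (m + 1) k tn))
      (((c (m + 1) : ℝ))⁻¹ • ∑ k ∈ Finset.Icc 1 (c (m + 1)), uk k, uk)

open Filter Asymptotics Set

section LipschitzBigO

variable {α E : Type*} [NormedAddCommGroup E]

theorem ContinuousOn.isBigO_one_comp {l : Filter α} {g : ℝ → E} {s : Set ℝ} {τ : α → ℝ}
    (hg : ContinuousOn g s) (hs : IsCompact s) (hτ : Tendsto τ l (𝓟 s)) :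
    (fun p => g (τ p)) =O[l] fun _ => (1 : ℝ) := by
  obtain ⟨B, hB⟩ := hs.exists_bound_of_continuousOn hg
  refine IsBigO.of_bound B ?_
  filter_upwards [tendsto_principal.1 hτ] with p hp
  simpa using hB _ hp

theorem LipschitzOnWith.isBigO_sub_comp {l : Filter α} {g : ℝ → E} {s : Set ℝ} {K : NNReal}
    {σ τ : α → ℝ} (hg : LipschitzOnWith K g s) (hσ : Tendsto σ l (𝓟 s))
    (hτ : Tendsto τ l (𝓟 s)) :
    (fun p => g (σ p) - g (τ p)) =O[l] fun p => σ p - τ p := by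
  refine IsBigO.of_bound K ?_
  filter_upwards [tendsto_principal.1 hσ, tendsto_principal.1 hτ] with p hp hq
  exact hg.norm_sub_le hp hq

theorem exists_lipschitzOnWith_iff_isBigO {g : ℝ → E} {s : Set ℝ} :
    (∃ K, LipschitzOnWith K g s) ↔
      (fun p : ℝ × ℝ => g p.1 - g p.2) =O[𝓟 (s ×ˢ s)] fun p => p.1 - p.2 := by
  constructor
  · rintro ⟨K, hK⟩
    exact hK.isBigO_sub_comp (tendsto_principal_principal.2 fun p hp => hp.1)
      (tendsto_principal_principal.2 fun p hp => hp.2)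
  · intro h
    obtain ⟨c, hc⟩ := isBigO_principal.1 h
    exact ⟨c.toNNReal, LipschitzOnWith.of_dist_le' fun x hx y hy => by
      simpa [dist_eq_norm] using hc (x, y) ⟨hx, hy⟩⟩

theorem exists_lipschitzOnWith_sum {ι : Type*} {I : Finset ι} {g : ι → ℝ → E} {s : Set ℝ}
    (h : ∀ i ∈ I, ∃ K, LipschitzOnWith K (g i) s) :
    ∃ K, LipschitzOnWith K (fun t => ∑ i ∈ I, g i t) s := by
  simp only [exists_lipschitzOnWith_iff_isBigO] at *
  exact (IsBigO.sum h).congr_left fun p => by simp [Finset.sum_sub_distrib]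

end LipschitzBigO

section EulerLike

variable {α E F : Type*} [NormedAddCommGroup E] [NormedSpace ℝ E] [NormedAddCommGroup F]
  [NormedSpace ℝ F]

theorem isBigO_clm_apply {l : Filter α} {L : α → E →L[ℝ] F} {x : α → E} {a b : α → ℝ}
    (hL : L =O[l] a) (hx : x =O[l] b) : (fun p => L p (x p)) =O[l] fun p => a p * b p :=
  (IsBigO.of_norm_le fun p => by
    simpa using (L p).le_opNorm (x p)).trans (hL.norm_left.mul hx.norm_left)

theorem exists_norm_euler_defect_le {T : ℝ} {G : ℝ → E →L[ℝ] E} {g u : ℝ → E}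
    (hG : ∃ K, LipschitzOnWith K G (Icc 0 T)) (hg : ∃ K, LipschitzOnWith K g (Icc 0 T))
    (hu : ∀ t ∈ Icc (0 : ℝ) T, HasDerivAt u (-(G t (u t) + g t)) t) :
    ∃ K, ∀ t h : ℝ, 0 ≤ t → 0 ≤ h → t + h ≤ T →
      ‖u (t + h) - (u t - h • (G t (u t) + g t))‖ ≤ K * h ^ 2 := by
  obtain ⟨KG, hG⟩ := hG
  obtain ⟨Kg, hg⟩ := hg
  have huc : ContinuousOn u (Icc 0 T) := fun t ht => (hu t ht).continuousAt.continuousWithinAt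
  have hDc : ContinuousOn (fun t => -(G t (u t) + g t)) (Icc 0 T) :=
    ((hG.continuousOn.clm_apply huc).add hg.continuousOn).neg
  obtain ⟨B, hB⟩ := isCompact_Icc.exists_bound_of_continuousOn hDc
  have hul : LipschitzOnWith B.toNNReal u (Icc 0 T) :=
    LipschitzOnWith.of_dist_le' fun x hx y hy => by
      rw [dist_eq_norm, dist_eq_norm]
      exact (convex_Icc 0 T).norm_image_sub_le_of_norm_hasDerivWithin_le
        (fun t ht => (hu t ht).hasDerivWithinAt) hB hy hx
  have hfst : Tendsto Prod.fst (𝓟 (Icc 0 T ×ˢ Icc 0 T)) (𝓟 (Icc (0 : ℝ) T)) :=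
    tendsto_principal_principal.2 fun p hp => hp.1
  have hsnd : Tendsto Prod.snd (𝓟 (Icc 0 T ×ˢ Icc 0 T)) (𝓟 (Icc (0 : ℝ) T)) :=
    tendsto_principal_principal.2 fun p hp => hp.2
  have hD : (fun p : ℝ × ℝ => (G p.1 (u p.1) + g p.1) - (G p.2 (u p.2) + g p.2))
      =O[𝓟 (Icc 0 T ×ˢ Icc 0 T)] fun p => p.1 - p.2 := by
    have h₁ := isBigO_clm_apply (hG.continuousOn.isBigO_one_comp isCompact_Icc hfst)
      (hul.isBigO_sub_comp hfst hsnd)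
    have h₂ := isBigO_clm_apply (hG.isBigO_sub_comp hfst hsnd)
      (huc.isBigO_one_comp isCompact_Icc hsnd)
    simp only [one_mul, mul_one] at h₁ h₂
    refine ((h₁.add h₂).add (hg.isBigO_sub_comp hfst hsnd)).congr_left fun p => ?_
    simp only [map_sub, sub_apply]
    abel
  obtain ⟨K, hK⟩ :=
    (exists_lipschitzOnWith_iff_isBigO (g := fun t => G t (u t) + g t)).2 hD
  refine ⟨K, fun t h ht hh hT => ?_⟩
  have hsub : Icc t (t + h) ⊆ Icc 0 T := Icc_subset_Icc ht hT
  have htm : t ∈ Icc t (t + h) := ⟨le_rfl, by linarith⟩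
  have hmv := (convex_Icc t (t + h)).norm_image_sub_le_of_norm_hasDerivWithin_le
    (f := fun s => u s + s • (G t (u t) + g t))
    (f' := fun s => -(G s (u s) + g s) + (1 : ℝ) • (G t (u t) + g t)) (C := K * h)
    (fun s hs => ((hu s (hsub hs)).add
      ((hasDerivAt_id s).smul_const (G t (u t) + g t))).hasDerivWithinAt)
    (fun s hs => by
      have := hK.norm_sub_le (hsub htm) (hsub hs)
      have hts : ‖t - s‖ ≤ h := by
        rw [Real.norm_eq_abs, abs_le]; constructor <;> linarith [hs.1, hs.2]
      rw [one_smul, neg_add_eq_sub]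
      exact this.trans (by gcongr))
    htm (y := t + h) ⟨by linarith, le_rfl⟩
  rw [add_sub_cancel_left, Real.norm_of_nonneg hh] at hmv
  convert hmv using 1
  · congr 1; rw [add_smul]; abel
  · ring

theorem le_of_succ_le_one_add_mul {e : ℕ → ℝ} {a b : ℝ} {N : ℕ} (ha : 0 ≤ a) (hb : 0 ≤ b)
    (h₀ : e 0 = 0) (he : ∀ n < N, e (n + 1) ≤ (1 + a) * e n + b) :
    ∀ n ≤ N, e n ≤ n * b * Real.exp (n * a) := by
  intro n
  induction n with
  | zero => simp [h₀]
  | succ n ih =>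
    intro hn
    have h₁ := ih (by omega)
    have h₂ : 1 + a ≤ Real.exp a := by linarith [Real.add_one_le_exp a]
    have h₃ : Real.exp ((n + 1 : ℕ) * a) = Real.exp a * Real.exp (n * a) := by
      rw [← Real.exp_add]; push_cast; ring_nf
    have h₄ : 1 ≤ Real.exp ((n + 1 : ℕ) * a) := Real.one_le_exp (by positivity)
    calc e (n + 1) ≤ (1 + a) * e n + b := he n (by omega)
      _ ≤ (1 + a) * (n * b * Real.exp (n * a)) + b := by gcongr
      _ ≤ Real.exp a * (n * b * Real.exp (n * a)) + b * Real.exp ((n + 1 : ℕ) * a) := by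
          gcongr
          nlinarith
      _ = (n + 1 : ℕ) * b * Real.exp ((n + 1 : ℕ) * a) := by rw [h₃]; push_cast; ring

theorem exists_norm_sub_le_of_euler_like {T : ℝ} (hT : 0 < T) {G : ℝ → E →L[ℝ] E}
    {g u : ℝ → E} {uN : ℕ → ℕ → E} {K : ℝ}
    (hG : ∃ K, LipschitzOnWith K G (Icc 0 T)) (hg : ∃ K, LipschitzOnWith K g (Icc 0 T))
    (hu : ∀ t ∈ Icc (0 : ℝ) T, HasDerivAt u (-(G t (u t) + g t)) t)
    (huN₀ : ∀ N, uN N 0 = u 0)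
    (huN : ∀ N n : ℕ, n < N → ‖uN N (n + 1) - (uN N n - (T / N) •
      (G (n * (T / N)) (uN N n) + g (n * (T / N))))‖ ≤ K * ((T / N) ^ 2 * (1 + ‖uN N n‖))) :
    ∃ C > (0 : ℝ), ∃ N₀ : ℕ, ∀ N ≥ N₀, ∀ n ≤ N,
      ‖uN N n - u (n * (T / N))‖ ≤ C * (T / N) := by
  obtain ⟨K', hK'⟩ := exists_norm_euler_defect_le hG hg hu
  obtain ⟨KG, hG⟩ := hG
  obtain ⟨B, hB⟩ := isCompact_Icc.exists_bound_of_continuousOn hG.continuousOn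
  obtain ⟨U, hU⟩ := isCompact_Icc.exists_bound_of_continuousOn
    (fun t ht => (hu t ht).continuousAt.continuousWithinAt : ContinuousOn u (Icc 0 T))
  have hB₀ : 0 ≤ B := (norm_nonneg _).trans (hB 0 ⟨le_rfl, hT.le⟩)
  have hU₀ : 0 ≤ U := (norm_nonneg _).trans (hU 0 ⟨le_rfl, hT.le⟩)
  set L : ℝ := B + |K| * T with hL
  set Q : ℝ := |K| * (1 + U) + |K'| with hQ
  have hL₀ : 0 ≤ L := by positivity
  have hQ₀ : 0 ≤ Q := by positivity
  refine ⟨T * Q * Real.exp (T * L) + 1, by positivity, 1, fun N hN n hn => ?_⟩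
  have hN₀ : (0 : ℝ) < N := by exact_mod_cast hN
  set h : ℝ := T / N with hh
  have hh₀ : 0 < h := by positivity
  have hNh : N * h = T := by rw [hh]; field_simp
  have hle : ∀ k : ℕ, k ≤ N → k * h ≤ T := fun k hk => by
    rw [← hNh]; gcongr
  have hhT : h ≤ T := by simpa using hle 1 hN
  have hstep : ∀ k < N, ‖uN N (k + 1) - u ((k + 1 : ℕ) * h)‖ ≤
      (1 + h * L) * ‖uN N k - u (k * h)‖ + Q * h ^ 2 := by
    intro k hk
    have ht₀ : 0 ≤ k * h := by positivity
    have htT : k * h ∈ Icc 0 T := ⟨ht₀, hle k hk.le⟩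
    have hkh : ((k + 1 : ℕ) : ℝ) * h = k * h + h := by push_cast; ring
    have h₁ := huN N k hk
    have h₂ := hK' (k * h) h ht₀ hh₀.le (hkh ▸ hle (k + 1) hk)
    rw [hkh]
    set t := (k : ℝ) * h
    set x := uN N k
    have h₃ : ‖G t (x - u t)‖ ≤ B * ‖x - u t‖ :=
      ((G t).le_opNorm _).trans (by gcongr; exact hB t htT)
    have h₄ : ‖x‖ ≤ ‖x - u t‖ + U := by
      have := norm_add_le (x - u t) (u t)
      rw [sub_add_cancel] at this
      linarith [hU t htT]
    have hsplit : uN N (k + 1) - u (t + h) =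
        (uN N (k + 1) - (x - h • (G t x + g t))) + (x - u t) - h • G t (x - u t)
          - (u (t + h) - (u t - h • (G t (u t) + g t))) := by
      simp only [map_sub, smul_sub, smul_add]; abel
    have h₅ : ‖uN N (k + 1) - u (t + h)‖ ≤ K * (h ^ 2 * (1 + ‖x‖)) + ‖x - u t‖
        + h * (B * ‖x - u t‖) + K' * h ^ 2 := by
      rw [hsplit]
      refine (norm_sub_le _ _).trans (add_le_add ((norm_sub_le _ _).trans
        (add_le_add ((norm_add_le _ _).trans (add_le_add h₁ le_rfl)) ?_)) h₂)
      rw [norm_smul, Real.norm_of_nonneg hh₀.le]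
      gcongr
    have h₆ : K * (h ^ 2 * (1 + ‖x‖)) ≤ |K| * (h ^ 2 * (1 + (‖x - u t‖ + U))) := by
      gcongr
      exact le_abs_self K
    have h₇ : K' * h ^ 2 ≤ |K'| * h ^ 2 := by
      gcongr
      exact le_abs_self K'
    have h₈ : |K| * (h * h * ‖x - u t‖) ≤ |K| * (h * T * ‖x - u t‖) := by gcongr
    rw [hL, hQ]
    nlinarith
  have hfin := le_of_succ_le_one_add_mul (e := fun k : ℕ => ‖uN N k - u (k * h)‖)
    (a := h * L) (b := Q * h ^ 2) (by positivity) (by positivity) (by simp [huN₀]) hstep n hn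
  have hnT := hle n hn
  calc ‖uN N n - u (n * h)‖ ≤ n * (Q * h ^ 2) * Real.exp (n * (h * L)) := hfin
    _ = (n * h) * Q * Real.exp ((n * h) * L) * h := by ring_nf
    _ ≤ T * Q * Real.exp (T * L) * h := by gcongr
    _ ≤ (T * Q * Real.exp (T * L) + 1) * h := by linarith

end EulerLike

section Resolvent

variable {d : ℕ} {S : Matrix (Fin d) (Fin d) ℝ} {h : ℝ}

theorem resolvent_add_smul (hS : S.PosDef) (hh : 0 ≤ h) (v : EuclideanSpace ℝ (Fin d)) :
    matApp (1 + h • S)⁻¹ v + h • matApp S (matApp (1 + h • S)⁻¹ v) = v := by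
  have hu : IsUnit (1 + h • S).det := (Matrix.isUnit_iff_isUnit_det _).1
    (Matrix.PosDef.one.add_posSemidef (hS.posSemidef.smul hh)).isUnit
  have := congrArg (fun B => Matrix.toEuclideanCLM (𝕜 := ℝ) B v)
    (Matrix.mul_nonsing_inv (1 + h • S) hu)
  simpa [matApp, map_mul, map_add, map_one, map_smul] using this

theorem norm_resolvent_le (hS : S.PosDef) (hh : 0 ≤ h) (v : EuclideanSpace ℝ (Fin d)) :
    ‖matApp (1 + h • S)⁻¹ v‖ ≤ ‖v‖ := by
  have hw := resolvent_add_smul hS hh v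
  set w := matApp (1 + h • S)⁻¹ v
  have hpos : 0 ≤ inner ℝ w (matApp S w) := by
    have := hS.posSemidef.dotProduct_mulVec_nonneg w.ofLp
    rw [EuclideanSpace.inner_eq_star_dotProduct, dotProduct_comm]
    simpa [matApp, Matrix.ofLp_toEuclideanCLM] using this
  have h₁ : ‖w‖ * ‖w‖ ≤ ‖w‖ * ‖v‖ := by
    refine le_trans ?_ (real_inner_le_norm w v)
    rw [← hw, inner_add_right, inner_smul_right, real_inner_self_eq_norm_mul_norm]
    linarith [mul_nonneg hh hpos]
  by_contra! hlt
  nlinarith [norm_nonneg v]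

end Resolvent

section HybridSplitting

variable {d : ℕ} {c : ℕ → ℕ} {A : ℕ → ℕ → ℕ → ℝ → Matrix (Fin d) (Fin d) ℝ}
  {S : ℕ → ℕ → ℝ → Matrix (Fin d) (Fin d) ℝ} {f : ℕ → ℕ → ℝ → EuclideanSpace ℝ (Fin d)}

/-- The contribution of channel `k` of block `m` to the right-hand side of the linear ODE. -/
noncomputable def channelField (c : ℕ → ℕ) (A : ℕ → ℕ → ℕ → ℝ → Matrix (Fin d) (Fin d) ℝ)
    (S : ℕ → ℕ → ℝ → Matrix (Fin d) (Fin d) ℝ) (f : ℕ → ℕ → ℝ → EuclideanSpace ℝ (Fin d))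
    (m k : ℕ) (t : ℝ) (v : EuclideanSpace ℝ (Fin d)) : EuclideanSpace ℝ (Fin d) :=
  (∑ s ∈ Finset.Icc 1 (c (m - 1)), matApp (A m k s t) v) + matApp (S m k t) v + f m k t

/-- Triples `(h, t, v)` of a step size, a time and a state such that `t` and `t + h` lie in
`[0, T]`. -/
def admissibleSteps (d : ℕ) (T : ℝ) : Set (ℝ × ℝ × EuclideanSpace ℝ (Fin d)) :=
  {p | 0 ≤ p.1 ∧ 0 ≤ p.2.1 ∧ p.2.1 + p.1 ≤ T}

theorem tendsto_time_admissibleSteps (d : ℕ) (T : ℝ) :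
    Tendsto (fun p : ℝ × ℝ × EuclideanSpace ℝ (Fin d) => p.2.1) (𝓟 (admissibleSteps d T))
      (𝓟 (Icc 0 T)) :=
  tendsto_principal_principal.2 fun _ ⟨h₁, h₂, h₃⟩ => ⟨h₂, by linarith⟩

theorem tendsto_next_time_admissibleSteps (d : ℕ) (T : ℝ) :
    Tendsto (fun p : ℝ × ℝ × EuclideanSpace ℝ (Fin d) => p.2.1 + p.1)
      (𝓟 (admissibleSteps d T)) (𝓟 (Icc 0 T)) :=
  tendsto_principal_principal.2 fun _ ⟨h₁, h₂, h₃⟩ => ⟨by linarith, h₃⟩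

theorem isBigO_one_step_admissibleSteps (d : ℕ) (T : ℝ) :
    (fun p : ℝ × ℝ × EuclideanSpace ℝ (Fin d) => p.1) =O[𝓟 (admissibleSteps d T)]
      fun _ => (1 : ℝ) :=
  isBigO_principal.2 ⟨T, fun p ⟨h₁, h₂, h₃⟩ => by
    rw [Real.norm_of_nonneg h₁, norm_one]; linarith⟩

theorem hybridSub_isBigO {M : ℕ} {T : ℝ} (hc : ∀ m, 1 ≤ m → m ≤ M → 1 ≤ c m) {LA LS Lf : NNReal}
    (hA : ∀ m ∈ Finset.Icc 1 M, ∀ k ∈ Finset.Icc 1 (c m), ∀ s ∈ Finset.Icc 1 (c (m - 1)),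
      LipschitzOnWith LA (fun t => Matrix.toEuclideanCLM (𝕜 := ℝ) (A m k s t)) (Icc 0 T))
    (hS : ∀ m ∈ Finset.Icc 1 M, ∀ k ∈ Finset.Icc 1 (c m),
      LipschitzOnWith LS (fun t => Matrix.toEuclideanCLM (𝕜 := ℝ) (S m k t)) (Icc 0 T))
    (hS_pd : ∀ m ∈ Finset.Icc 1 M, ∀ k ∈ Finset.Icc 1 (c m),
      ∀ t ∈ Icc (0 : ℝ) T, (S m k t).PosDef)
    (hf : ∀ m ∈ Finset.Icc 1 M, ∀ k ∈ Finset.Icc 1 (c m),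
      LipschitzOnWith Lf (f m k) (Icc 0 T)) (m : ℕ) (hm : m ≤ M) :
    ((fun p => (hybridSub d c A S f p.1 p.2.1 (p.2.1 + p.1) p.2.2 m).1 -
        (p.2.2 - p.1 • ∑ j ∈ Finset.Icc 1 m, ∑ k ∈ Finset.Icc 1 (c j),
          channelField c A S f j k p.2.1 p.2.2))
      =O[𝓟 (admissibleSteps d T)] fun p => p.1 * (p.1 * (1 + ‖p.2.2‖))) ∧
    ∀ s ∈ Finset.Icc 1 (c m),
      (fun p => (hybridSub d c A S f p.1 p.2.1 (p.2.1 + p.1) p.2.2 m).2 s - p.2.2)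
        =O[𝓟 (admissibleSteps d T)] fun p => p.1 * (1 + ‖p.2.2‖) := by
  have hτ₀ := tendsto_time_admissibleSteps d T
  have hτ₁ := tendsto_next_time_admissibleSteps d T
  have hh₁ := isBigO_one_step_admissibleSteps d T
  set l := 𝓟 (admissibleSteps d T)
  have hv : (fun p : ℝ × ℝ × EuclideanSpace ℝ (Fin d) => p.2.2) =O[l] fun p => 1 + ‖p.2.2‖ :=
    IsBigO.of_norm_le fun p => by linarith
  have h1W : (fun _ : ℝ × ℝ × EuclideanSpace ℝ (Fin d) => (1 : ℝ)) =O[l] fun p => 1 + ‖p.2.2‖ :=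
    IsBigO.of_norm_le fun p => by simp
  have hmul {g : ℝ × ℝ × EuclideanSpace ℝ (Fin d) → ℝ} :
      (fun p => p.1 * g p) =O[l] g := by
    simpa using hh₁.mul (isBigO_refl g l)
  have hsmul {X : ℝ × ℝ × EuclideanSpace ℝ (Fin d) → EuclideanSpace ℝ (Fin d)}
      {g : ℝ × ℝ × EuclideanSpace ℝ (Fin d) → ℝ} (hX : X =O[l] g) (a : ℝ) :
      (fun p => (a * p.1) • X p) =O[l] fun p => p.1 * g p := by
    simpa using ((isBigO_refl (fun p : ℝ × ℝ × EuclideanSpace ℝ (Fin d) => p.1) l).const_mul_left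
      a).smul hX
  have hAO {m k s : ℕ} (hm : m ∈ Finset.Icc 1 M) (hk : k ∈ Finset.Icc 1 (c m))
      (hs : s ∈ Finset.Icc 1 (c (m - 1)))
      {X : ℝ × ℝ × EuclideanSpace ℝ (Fin d) → EuclideanSpace ℝ (Fin d)}
      {g : ℝ × ℝ × EuclideanSpace ℝ (Fin d) → ℝ} (hX : X =O[l] g) :
      (fun p => matApp (A m k s p.2.1) (X p)) =O[l] g := by
    simpa [matApp] using isBigO_clm_apply
      ((hA m hm k hk s hs).continuousOn.isBigO_one_comp isCompact_Icc hτ₀) hX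
  have hSO {m k : ℕ} (hm : m ∈ Finset.Icc 1 M) (hk : k ∈ Finset.Icc 1 (c m))
      {τ : ℝ × ℝ × EuclideanSpace ℝ (Fin d) → ℝ} (hτ : Tendsto τ l (𝓟 (Icc 0 T)))
      {X : ℝ × ℝ × EuclideanSpace ℝ (Fin d) → EuclideanSpace ℝ (Fin d)}
      {g : ℝ × ℝ × EuclideanSpace ℝ (Fin d) → ℝ} (hX : X =O[l] g) :
      (fun p => matApp (S m k (τ p)) (X p)) =O[l] g := by
    simpa [matApp] using isBigO_clm_apply
      ((hS m hm k hk).continuousOn.isBigO_one_comp isCompact_Icc hτ) hX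
  have hfO {m k : ℕ} (hm : m ∈ Finset.Icc 1 M) (hk : k ∈ Finset.Icc 1 (c m)) :
      (fun p : ℝ × ℝ × EuclideanSpace ℝ (Fin d) => f m k p.2.1) =O[l] fun p => 1 + ‖p.2.2‖ :=
    ((hf m hm k hk).continuousOn.isBigO_one_comp isCompact_Icc hτ₀).trans h1W
  have hfield {m k : ℕ} (hm : m ∈ Finset.Icc 1 M) (hk : k ∈ Finset.Icc 1 (c m)) :
      (fun p => channelField c A S f m k p.2.1 p.2.2) =O[l] fun p => 1 + ‖p.2.2‖ :=
    ((IsBigO.fun_sum fun s hs => hAO hm hk hs hv).add (hSO hm hk hτ₀ hv)).add (hfO hm hk)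
  induction m with
  | zero =>
    constructor
    · simpa [hybridSub] using isBigO_zero _ _
    · intro s _
      simpa [hybridSub] using isBigO_zero _ _
  | succ m ih =>
    obtain ⟨hP, hq⟩ := ih (by omega)
    have hm' : m + 1 ∈ Finset.Icc 1 M := Finset.mem_Icc.2 ⟨by omega, hm⟩
    set C : ℝ := (c (m + 1) : ℝ) with hC
    have hC₀ : 0 < C := Nat.cast_pos.2 (hc (m + 1) (by omega) hm)
    set P := fun p : ℝ × ℝ × EuclideanSpace ℝ (Fin d) =>
      (hybridSub d c A S f p.1 p.2.1 (p.2.1 + p.1) p.2.2 m).1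
    set q := fun (s : ℕ) (p : ℝ × ℝ × EuclideanSpace ℝ (Fin d)) =>
      (hybridSub d c A S f p.1 p.2.1 (p.2.1 + p.1) p.2.2 m).2 s with hqdef
    set x := fun (k : ℕ) (p : ℝ × ℝ × EuclideanSpace ℝ (Fin d)) =>
      P p - (C * p.1) • ((∑ s ∈ Finset.Icc 1 (c m), matApp (A (m + 1) k s p.2.1) (q s p))
        + f (m + 1) k p.2.1) with hxdef
    set r := fun (k : ℕ) (p : ℝ × ℝ × EuclideanSpace ℝ (Fin d)) =>
      matApp ((1 + (C * p.1) • S (m + 1) k (p.2.1 + p.1))⁻¹) (x k p)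
    have hstep (p : ℝ × ℝ × EuclideanSpace ℝ (Fin d)) :
        hybridSub d c A S f p.1 p.2.1 (p.2.1 + p.1) p.2.2 (m + 1) =
          (C⁻¹ • ∑ k ∈ Finset.Icc 1 (c (m + 1)), r k p, fun k => r k p) := rfl
    have hPv : (fun p => P p - p.2.2) =O[l] fun p => p.1 * (1 + ‖p.2.2‖) := by
      have hsum := hsmul (IsBigO.fun_sum (s := Finset.Icc 1 m) fun j hj =>
        IsBigO.fun_sum (s := Finset.Icc 1 (c j)) fun k hk =>
          hfield (m := j) (Finset.Icc_subset_Icc_right (by omega) hj) hk) 1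
      refine ((hP.trans hmul).sub hsum).congr_left fun p => ?_
      rw [one_mul]
      abel
    have hqW {s : ℕ} (hs : s ∈ Finset.Icc 1 (c m)) : q s =O[l] fun p => 1 + ‖p.2.2‖ :=
      (((hq s hs).trans hmul).add hv).congr_left fun p => by simp [hqdef]
    have hx {k : ℕ} (hk : k ∈ Finset.Icc 1 (c (m + 1))) :
        (fun p => x k p - p.2.2) =O[l] fun p => p.1 * (1 + ‖p.2.2‖) := by
      have hG := hsmul ((IsBigO.fun_sum fun s hs => hAO hm' hk hs (hqW hs)).add (hfO hm' hk)) C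
      refine (hPv.sub hG).congr_left fun p => ?_
      simp only [hxdef, Nat.add_sub_cancel]
      abel
    have hres {k : ℕ} (hk : k ∈ Finset.Icc 1 (c (m + 1)))
        {p : ℝ × ℝ × EuclideanSpace ℝ (Fin d)} (hp : p ∈ admissibleSteps d T) :
        (S (m + 1) k (p.2.1 + p.1)).PosDef ∧ 0 ≤ C * p.1 :=
      ⟨hS_pd _ hm' k hk _ ⟨add_nonneg hp.2.1 hp.1, hp.2.2⟩, mul_nonneg hC₀.le hp.1⟩
    have hrx {k : ℕ} (hk : k ∈ Finset.Icc 1 (c (m + 1))) :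
        ∀ᶠ p in l, r k p + (C * p.1) • matApp (S (m + 1) k (p.2.1 + p.1)) (r k p) = x k p :=
      eventually_principal.2 fun p hp =>
        resolvent_add_smul (hres hk hp).1 (hres hk hp).2 (x k p)
    have hrW {k : ℕ} (hk : k ∈ Finset.Icc 1 (c (m + 1))) : r k =O[l] fun p => 1 + ‖p.2.2‖ := by
      have hxW : x k =O[l] fun p => 1 + ‖p.2.2‖ :=
        (((hx hk).trans hmul).add hv).congr_left fun p => by simp
      refine IsBigO.trans (isBigO_principal.2 ⟨1, fun p hp => ?_⟩) hxW
      rw [one_mul]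
      exact norm_resolvent_le (hres hk hp).1 (hres hk hp).2 (x k p)
    have hrv {k : ℕ} (hk : k ∈ Finset.Icc 1 (c (m + 1))) :
        (fun p => r k p - p.2.2) =O[l] fun p => p.1 * (1 + ‖p.2.2‖) := by
      refine ((hx hk).sub (hsmul (hSO hm' hk hτ₁ (hrW hk)) C)).congr' ?_ .rfl
      filter_upwards [hrx hk] with p hp
      rw [← hp]
      abel
    have hrP {k : ℕ} (hk : k ∈ Finset.Icc 1 (c (m + 1))) :
        (fun p => r k p - (P p - (C * p.1) • channelField c A S f (m + 1) k p.2.1 p.2.2))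
          =O[l] fun p => p.1 * (p.1 * (1 + ‖p.2.2‖)) := by
      have hSd : (fun p => matApp (S (m + 1) k (p.2.1 + p.1)) p.2.2 -
          matApp (S (m + 1) k p.2.1) p.2.2) =O[l] fun p => p.1 * (1 + ‖p.2.2‖) := by
        refine (isBigO_clm_apply ((hS _ hm' k hk).isBigO_sub_comp hτ₁ hτ₀) hv).congr
          (fun p => ?_) fun p => ?_
        · simp [matApp]
        · simp
      refine (hsmul (((IsBigO.fun_sum fun s hs => hAO hm' hk hs (hq s hs)).add
        (hSO hm' hk hτ₁ (hrv hk))).add hSd) (-C)).congr' ?_ .rfl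
      filter_upwards [hrx hk] with p hp
      rw [← sub_eq_zero, ← sub_eq_zero.2 hp.symm]
      simp only [hxdef, channelField, matApp, map_sub, Finset.sum_sub_distrib,
        Nat.add_sub_cancel]
      module
    refine ⟨?_, fun s hs => hrv hs⟩
    refine (((IsBigO.fun_sum fun k hk => hrP hk).const_smul_left C⁻¹).add hP).congr_left
      fun p => ?_
    simp only [hstep, Pi.smul_apply, Finset.sum_sub_distrib, Finset.sum_const, Nat.card_Icc,
      Nat.add_sub_cancel, ← Finset.smul_sum, smul_sub, ← Nat.cast_smul_eq_nsmul ℝ, ← hC, smul_smul,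
      ← mul_assoc, inv_mul_cancel₀ hC₀.ne', one_mul, one_smul,
      Finset.sum_Icc_succ_top (show 1 ≤ m + 1 by omega), smul_add]
    abel

end HybridSplitting

/-- **First-order accuracy of the hybrid splitting scheme (Theorem `thm.hybrid`).**
Let `d ≥ 1`, `T > 0`, `M ≥ 1`, `c 0 = 1` and `c m ≥ 1` for `1 ≤ m ≤ M`.  Suppose each
`A m k s`, `S m k` is Lipschitz in `t` on `[0,T]` with symmetric positive definite values and
each `f m k` is Lipschitz, `u` is the exact solution of the linear ODE, and for each `N` the
iterates `uN N n` are produced by the scheme with step `Δt = T / N`.  Then there are `C > 0`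
and `N₀` such that `‖uN N n − u (n Δt)‖ ≤ C Δt` for all `N ≥ N₀` and `0 ≤ n ≤ N`. -/
theorem hybrid_splitting_first_order_accurate
    (d M : ℕ) (hd : 1 ≤ d) (hM : 1 ≤ M) (T : ℝ) (hT : 0 < T)
    (c : ℕ → ℕ) (hc0 : c 0 = 1) (hc : ∀ m, 1 ≤ m → m ≤ M → 1 ≤ c m)
    (A : ℕ → ℕ → ℕ → ℝ → Matrix (Fin d) (Fin d) ℝ)
    (S : ℕ → ℕ → ℝ → Matrix (Fin d) (Fin d) ℝ)
    (f : ℕ → ℕ → ℝ → EuclideanSpace ℝ (Fin d))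
    (LA LS Lf : NNReal)
    (hA_lip : ∀ m ∈ Finset.Icc 1 M, ∀ k ∈ Finset.Icc 1 (c m), ∀ s ∈ Finset.Icc 1 (c (m - 1)),
      LipschitzOnWith LA (fun t => Matrix.toEuclideanCLM (𝕜 := ℝ) (A m k s t)) (Set.Icc 0 T))
    (hA_pd : ∀ m ∈ Finset.Icc 1 M, ∀ k ∈ Finset.Icc 1 (c m), ∀ s ∈ Finset.Icc 1 (c (m - 1)),
      ∀ t ∈ Set.Icc (0 : ℝ) T, (A m k s t).PosDef)
    (hS_lip : ∀ m ∈ Finset.Icc 1 M, ∀ k ∈ Finset.Icc 1 (c m),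
      LipschitzOnWith LS (fun t => Matrix.toEuclideanCLM (𝕜 := ℝ) (S m k t)) (Set.Icc 0 T))
    (hS_pd : ∀ m ∈ Finset.Icc 1 M, ∀ k ∈ Finset.Icc 1 (c m),
      ∀ t ∈ Set.Icc (0 : ℝ) T, (S m k t).PosDef)
    (hf_lip : ∀ m ∈ Finset.Icc 1 M, ∀ k ∈ Finset.Icc 1 (c m),
      LipschitzOnWith Lf (f m k) (Set.Icc 0 T))
    (u0 : EuclideanSpace ℝ (Fin d)) (u : ℝ → EuclideanSpace ℝ (Fin d))
    (hu0 : u 0 = u0)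
    (hu : ∀ t ∈ Set.Icc (0 : ℝ) T, HasDerivAt u
      (-(∑ m ∈ Finset.Icc 1 M,
          ((∑ k ∈ Finset.Icc 1 (c m), ∑ s ∈ Finset.Icc 1 (c (m - 1)),
              matApp (A m k s t) (u t))
            + (∑ k ∈ Finset.Icc 1 (c m), matApp (S m k t) (u t))
            + ∑ k ∈ Finset.Icc 1 (c m), f m k t))) t)
    (uN : ℕ → ℕ → EuclideanSpace ℝ (Fin d))
    (huN0 : ∀ N, uN N 0 = u0)
    (huNstep : ∀ N n : ℕ, uN N (n + 1) =
      (hybridSub d c A S f (T / N) (n * (T / N)) ((n + 1) * (T / N)) (uN N n) M).1) :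
    ∃ C > (0 : ℝ), ∃ N₀ : ℕ, ∀ N ≥ N₀, ∀ n ≤ N,
      ‖uN N n - u (n * (T / N))‖ ≤ C * (T / N) := by
  set G : ℝ → EuclideanSpace ℝ (Fin d) →L[ℝ] EuclideanSpace ℝ (Fin d) := fun t =>
    ∑ m ∈ Finset.Icc 1 M,
      ((∑ k ∈ Finset.Icc 1 (c m), ∑ s ∈ Finset.Icc 1 (c (m - 1)),
          Matrix.toEuclideanCLM (𝕜 := ℝ) (A m k s t))
        + ∑ k ∈ Finset.Icc 1 (c m), Matrix.toEuclideanCLM (𝕜 := ℝ) (S m k t)) with hGdef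
  set g : ℝ → EuclideanSpace ℝ (Fin d) := fun t =>
    ∑ m ∈ Finset.Icc 1 M, ∑ k ∈ Finset.Icc 1 (c m), f m k t with hgdef
  have hG : ∃ K, LipschitzOnWith K G (Set.Icc 0 T) := by
    refine exists_lipschitzOnWith_sum fun m hm => ?_
    obtain ⟨K₁, h₁⟩ := exists_lipschitzOnWith_sum fun k hk =>
      exists_lipschitzOnWith_sum fun s hs => ⟨LA, hA_lip m hm k hk s hs⟩
    obtain ⟨K₂, h₂⟩ := exists_lipschitzOnWith_sum fun k hk => ⟨LS, hS_lip m hm k hk⟩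
    exact ⟨_, h₁.add h₂⟩
  have hg : ∃ K, LipschitzOnWith K g (Set.Icc 0 T) :=
    exists_lipschitzOnWith_sum fun m hm =>
      exists_lipschitzOnWith_sum fun k hk => ⟨Lf, hf_lip m hm k hk⟩
  have hfield (t : ℝ) (v : EuclideanSpace ℝ (Fin d)) :
      ∑ m ∈ Finset.Icc 1 M, ∑ k ∈ Finset.Icc 1 (c m), channelField c A S f m k t v =
        G t v + g t := by
    simp only [hGdef, hgdef, channelField, matApp, Finset.sum_add_distrib,
      add_apply, _root_.sum_apply]
  obtain ⟨K, hK⟩ := isBigO_principal.1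
    (hybridSub_isBigO hc hA_lip hS_lip hS_pd hf_lip M le_rfl).1
  refine exists_norm_sub_le_of_euler_like (K := K) hT hG hg (fun t ht => ?_)
    (fun N => (huN0 N).trans hu0.symm) fun N n hn => ?_
  · refine (hu t ht).congr_deriv ?_
    rw [← hfield]
    simp only [channelField, Finset.sum_add_distrib]
  · have hN : (0 : ℝ) < N := by exact_mod_cast (Nat.zero_le n).trans_lt hn
    have hnN : ((n : ℝ) + 1) * (T / N) ≤ T := by
      calc ((n : ℝ) + 1) * (T / N) ≤ N * (T / N) := by
            gcongr
            exact_mod_cast hn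
        _ = T := by field_simp
    have hstep : ((n : ℝ) + 1) * (T / N) = n * (T / N) + T / N := by ring
    have h := hK (T / N, n * (T / N), uN N n)
      ⟨by positivity, by positivity, hstep ▸ hnN⟩
    rw [hfield, Real.norm_of_nonneg (by positivity)] at h
    rw [huNstep, hstep]
    refine h.trans_eq ?_
    ring
end

section
/- Let Ω ⊂ ℝ² have finite positive Lebesgue measure, let K ≥ 2, let f_1,…,f_K : Ω → ℝ be nonnegative integrable functions, let λ > 0 and σ > 0. Define the limiting Potts functional F(v) = Σ_{k=1}^K [ ∫_Ω v_k f_k dx + (λ/2) ∫_Ω v_k(x) (G_σ * (1_Ω − v_k))(x) dx ] on the constraint set S = { v = (v_1,…,v_K) : v_k : Ω → ℝ measurable, v_k ≥ 0 a.e., Σ_{k=1}^K v_k = 1 a.e. }, where each v_k is extended by zero outside Ω in the convolution. Then every minimizer u of F over S is binary: for a.e. x ∈ Ω, u(x) ∈ {0,1}^K. -/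
open MeasureTheory

/-- The plane `ℝ²`, with the Euclidean norm and Lebesgue measure. -/
abbrev Plane : Type := EuclideanSpace ℝ (Fin 2)

/-- The Gaussian kernel `G_σ(x) = (1/(2πσ²)) exp(−‖x‖²/(2σ²))` on `ℝ²`. -/
noncomputable def gaussKer (σ : ℝ) (x : Plane) : ℝ :=
  (1 / (2 * Real.pi * σ ^ 2)) * Real.exp (-‖x‖ ^ 2 / (2 * σ ^ 2))

/-- The convolution `(G_σ * w)(x) = ∫_{ℝ²} G_σ(x−y) w(y) dy`. -/
noncomputable def gaussConv (σ : ℝ) (w : Plane → ℝ) (x : Plane) : ℝ :=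
  ∫ y : Plane, gaussKer σ (x - y) * w y

/-- The constraint set `S` of the (relaxed, limiting) Potts model:
each `v_k` is measurable and nonnegative a.e. on `Ω`, and the `v_k` sum to `1` a.e. on `Ω`. -/
def pottsAdmissible (Ω : Set Plane) (K : ℕ) (v : Fin K → Plane → ℝ) : Prop :=
  (∀ k, Measurable (v k)) ∧
    (∀ k, ∀ᵐ x ∂(volume.restrict Ω), 0 ≤ v k x) ∧
    (∀ᵐ x ∂(volume.restrict Ω), ∑ k, v k x = 1)

/-- The limiting Potts functional
`F(v) = Σ_k [ ∫_Ω v_k f_k + (λ/2) ∫_Ω v_k (G_σ * (1_Ω − v_k)) ]`,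
each `v_k` being extended by zero outside `Ω` in the convolution. -/
noncomputable def pottsF (Ω : Set Plane) (K : ℕ) (f : Fin K → Plane → ℝ)
    (lam σ : ℝ) (v : Fin K → Plane → ℝ) : ℝ :=
  ∑ k : Fin K,
    ((∫ x in Ω, v k x * f k x) +
      (lam / 2) * ∫ x in Ω, v k x * gaussConv σ (Ω.indicator fun z => 1 - v k z) x)

lemma continuous_gaussKer (σ : ℝ) : Continuous (gaussKer σ) := by
  unfold gaussKer
  fun_prop

lemma gaussKer_pos {σ : ℝ} (hσ : 0 < σ) (x : Plane) : 0 < gaussKer σ x := by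
  unfold gaussKer
  positivity

lemma norm_gaussKer_le {σ : ℝ} (hσ : 0 < σ) (x : Plane) :
    ‖gaussKer σ x‖ ≤ 1 / (2 * Real.pi * σ ^ 2) := by
  rw [Real.norm_of_nonneg (gaussKer_pos hσ x).le]
  unfold gaussKer
  have h : Real.exp (-‖x‖ ^ 2 / (2 * σ ^ 2)) ≤ 1 := by
    rw [Real.exp_le_one_iff]
    apply div_nonpos_of_nonpos_of_nonneg
    · simp
    · positivity
  exact mul_le_of_le_one_right (by positivity) h

lemma integrable_gaussKer_mul {σ : ℝ} (hσ : 0 < σ) {q : Plane → ℝ} (hq : Integrable q)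
    (x : Plane) : Integrable fun y => gaussKer σ (x - y) * q y := by
  refine hq.bdd_mul (c := 1 / (2 * Real.pi * σ ^ 2)) ?_ (ae_of_all _ fun y => norm_gaussKer_le hσ _)
  exact ((continuous_gaussKer σ).comp (by fun_prop)).aestronglyMeasurable

lemma gaussConv_add_const_mul {σ : ℝ} (hσ : 0 < σ) {p q : Plane → ℝ} (hp : Integrable p)
    (hq : Integrable q) (c : ℝ) (x : Plane) :
    gaussConv σ (fun y => p y + c * q y) x = gaussConv σ p x + c * gaussConv σ q x := by
  unfold gaussConv
  rw [← integral_const_mul, ← integral_add (integrable_gaussKer_mul hσ hp x)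
    ((integrable_gaussKer_mul hσ hq x).const_mul c)]
  congr 1
  ext y
  ring

lemma measurable_gaussConv (σ : ℝ) {q : Plane → ℝ} (hq : Measurable q) :
    Measurable (gaussConv σ q) := by
  have h : Measurable fun z : Plane × Plane => gaussKer σ (z.1 - z.2) * q z.2 :=
    ((continuous_gaussKer σ).measurable.comp (by fun_prop)).mul (hq.comp measurable_snd)
  exact (h.stronglyMeasurable.integral_prod_right (ν := volume)).measurable

lemma norm_gaussConv_le {σ : ℝ} (hσ : 0 < σ) {q : Plane → ℝ} (hq : Integrable q) (x : Plane) :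
    ‖gaussConv σ q x‖ ≤ 1 / (2 * Real.pi * σ ^ 2) * ∫ y, ‖q y‖ := by
  unfold gaussConv
  rw [← integral_const_mul]
  refine norm_integral_le_of_norm_le (hq.norm.const_mul _) (ae_of_all _ fun y => ?_)
  rw [norm_mul]
  gcongr
  exact norm_gaussKer_le hσ _

lemma IntegrableOn.mul_gaussConv {Ω : Set Plane} {σ : ℝ} (hσ : 0 < σ) {p q : Plane → ℝ}
    (hp : IntegrableOn p Ω) (hqm : Measurable q) (hq : Integrable q) :
    IntegrableOn (fun x => p x * gaussConv σ q x) Ω :=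
  Integrable.mul_bdd hp (measurable_gaussConv σ hqm).aestronglyMeasurable
    (ae_of_all _ fun x => norm_gaussConv_le hσ hq x)

/-- The self-interaction of a non-null set of finite measure under the Gaussian kernel
is positive. -/
lemma integral_indicator_mul_gaussConv_pos {Ω A : Set Plane} {σ : ℝ} (hσ : 0 < σ)
    (hA : MeasurableSet A) (hAΩ : A ⊆ Ω) (hA0 : volume A ≠ 0) (hAfin : volume A ≠ ⊤) :
    0 < ∫ x in Ω, A.indicator 1 x * gaussConv σ (A.indicator 1) x := by
  have hint : Integrable (A.indicator (1 : Plane → ℝ)) :=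
    (integrable_indicator_iff hA).2 (integrableOn_const hAfin)
  have hmeas : Measurable (A.indicator (1 : Plane → ℝ)) := measurable_one.indicator hA
  have hpos : ∀ x, 0 < gaussConv σ (A.indicator 1) x := by
    intro x
    unfold gaussConv
    rw [integral_pos_iff_support_of_nonneg _ (integrable_gaussKer_mul hσ hint x)]
    · refine (pos_iff_ne_zero.2 hA0).trans_le (measure_mono fun y hy => ?_)
      simp [hy, (gaussKer_pos hσ (x - y)).ne']
    · intro y
      exact mul_nonneg (gaussKer_pos hσ _).le (Set.indicator_nonneg (fun _ _ => zero_le_one) y)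
  rw [integral_pos_iff_support_of_nonneg _
    (IntegrableOn.mul_gaussConv hσ hint.integrableOn hmeas hint)]
  · refine (pos_iff_ne_zero.2 ?_).trans_le (measure_mono (s := A) fun y hy => ?_)
    · rwa [Measure.restrict_apply hA, Set.inter_eq_left.2 hAΩ]
    · simp [hy, (hpos y).ne']
  · intro y
    exact mul_nonneg (Set.indicator_nonneg (fun _ _ => zero_le_one) y) (hpos y).le

/-- The contribution of a single phase to `pottsF`. -/
noncomputable def pottsPhase (Ω : Set Plane) (f : Plane → ℝ) (lam σ : ℝ) (w : Plane → ℝ) : ℝ :=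
  (∫ x in Ω, w x * f x) +
    (lam / 2) * ∫ x in Ω, w x * gaussConv σ (Ω.indicator fun z => 1 - w z) x

/-- The phase energy is quadratic, with an explicit symmetric second difference. -/
lemma pottsPhase_second_difference {Ω : Set Plane} (hΩ : MeasurableSet Ω)
    (hΩfin : volume Ω ≠ ⊤) {f : Plane → ℝ} (hf : IntegrableOn f Ω) {lam σ : ℝ} (hσ : 0 < σ)
    {w : Plane → ℝ} (hw : Measurable w) (hw0 : ∀ᵐ x ∂(volume.restrict Ω), 0 ≤ w x)
    (hw1 : ∀ᵐ x ∂(volume.restrict Ω), w x ≤ 1)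
    {A : Set Plane} (hA : MeasurableSet A) (hAΩ : A ⊆ Ω) (c : ℝ) :
    pottsPhase Ω f lam σ (fun x => w x + c * A.indicator 1 x) +
        pottsPhase Ω f lam σ (fun x => w x + -c * A.indicator 1 x) =
      2 * pottsPhase Ω f lam σ w -
        lam * c ^ 2 * ∫ x in Ω, A.indicator 1 x * gaussConv σ (A.indicator 1) x := by
  set φ : Plane → ℝ := A.indicator 1 with hφ
  have hφint : Integrable φ :=
    (integrable_indicator_iff hA).2 (integrableOn_const (measure_ne_top_of_subset hAΩ hΩfin))
  have hφmeas : Measurable φ := measurable_one.indicator hA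
  have hwb : ∀ᵐ x ∂(volume.restrict Ω), ‖w x‖ ≤ 1 := by
    filter_upwards [hw0, hw1] with x h0 h1
    rwa [Real.norm_of_nonneg h0]
  have hφb : ∀ᵐ x ∂(volume.restrict Ω), ‖φ x‖ ≤ 1 := ae_of_all _ fun x => by
    by_cases hx : x ∈ A <;> simp [hφ, hx]
  have h1int : IntegrableOn (fun _ : Plane => (1 : ℝ)) Ω := integrableOn_const hΩfin
  have hwint : IntegrableOn w Ω :=
    Integrable.mono' h1int hw.aestronglyMeasurable hwb
  set r : Plane → ℝ := Ω.indicator fun z => 1 - w z with hr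
  have hrmeas : Measurable r := (measurable_const.sub hw).indicator hΩ
  have hrint : Integrable r := (integrable_indicator_iff hΩ).2 (Integrable.sub h1int hwint)
  have hwf : IntegrableOn (fun x => w x * f x) Ω :=
    Integrable.bdd_mul hf hw.aestronglyMeasurable hwb
  have hφf : IntegrableOn (fun x => φ x * f x) Ω :=
    Integrable.bdd_mul hf hφmeas.aestronglyMeasurable hφb
  have hwr := IntegrableOn.mul_gaussConv hσ hwint hrmeas hrint
  have hwφ := IntegrableOn.mul_gaussConv hσ hwint hφmeas hφint
  have hφr := IntegrableOn.mul_gaussConv hσ hφint.integrableOn (Ω := Ω) hrmeas hrint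
  have hφφ := IntegrableOn.mul_gaussConv hσ hφint.integrableOn (Ω := Ω) hφmeas hφint
  have key : ∀ t : ℝ, pottsPhase Ω f lam σ (fun x => w x + t * φ x) =
      ((∫ x in Ω, w x * f x) + t * ∫ x in Ω, φ x * f x) +
        (lam / 2) * ((∫ x in Ω, w x * gaussConv σ r x) +
          (-t) * (∫ x in Ω, w x * gaussConv σ φ x) +
          t * (∫ x in Ω, φ x * gaussConv σ r x) +
          (-t ^ 2) * ∫ x in Ω, φ x * gaussConv σ φ x) := by
    intro t
    have hind : (Ω.indicator fun z => 1 - (w z + t * φ z)) = fun y => r y + (-t) * φ y := by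
      ext y
      by_cases hy : y ∈ Ω
      · simp only [hr, Set.indicator_of_mem hy]
        ring
      · have : y ∉ A := fun h => hy (hAΩ h)
        simp [hr, hφ, hy, this]
    unfold pottsPhase
    rw [hind]
    simp_rw [gaussConv_add_const_mul hσ hrint hφint]
    simp only [← integral_const_mul]
    congr 1
    · rw [← integral_add hwf (hφf.const_mul t)]
      congr 1
      ext x
      ring
    · rw [integral_const_mul]
      congr 1
      have h₁ : IntegrableOn (fun x => w x * gaussConv σ r x +
          -t * (w x * gaussConv σ φ x)) Ω := hwr.add (hwφ.const_mul _)
      have h₂ : IntegrableOn (fun x => w x * gaussConv σ r x +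
          -t * (w x * gaussConv σ φ x) + t * (φ x * gaussConv σ r x)) Ω :=
        h₁.add (hφr.const_mul _)
      rw [← integral_add hwr (hwφ.const_mul _), ← integral_add h₁ (hφr.const_mul _),
        ← integral_add h₂ (hφφ.const_mul _)]
      congr 1
      ext x
      ring
  rw [key c, key (-c)]
  unfold pottsPhase
  ring

lemma pottsAdmissible.le_one {Ω : Set Plane} {K : ℕ} {u : Fin K → Plane → ℝ}
    (hu : pottsAdmissible Ω K u) (k : Fin K) : ∀ᵐ x ∂(volume.restrict Ω), u k x ≤ 1 := by
  filter_upwards [ae_all_iff.2 hu.2.1, hu.2.2] with x h0 h1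
  rw [← h1]
  exact Finset.single_le_sum (fun j _ => h0 j) (Finset.mem_univ k)

lemma pottsAdmissible.add_indicator {Ω : Set Plane} {K : ℕ} {u : Fin K → Plane → ℝ}
    (hu : pottsAdmissible Ω K u) {A : Set Plane} (hA : MeasurableSet A) {c : Fin K → ℝ}
    (hc : ∑ k, c k = 0) (hcu : ∀ k, ∀ x ∈ A, c k < 0 → -c k ≤ u k x) :
    pottsAdmissible Ω K fun k x => u k x + c k * A.indicator 1 x := by
  refine ⟨fun k => (hu.1 k).add ((measurable_one.indicator hA).const_mul _), fun k => ?_, ?_⟩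
  · filter_upwards [hu.2.1 k] with x hx
    by_cases hxA : x ∈ A
    · rcases lt_or_ge (c k) 0 with h | h
      · have := hcu k x hxA h
        simp [hxA]
        linarith
      · simp [hxA]
        linarith
    · simpa [hxA] using hx
  · filter_upwards [hu.2.2] with x hx
    rw [Finset.sum_add_distrib, hx, ← Finset.sum_mul, hc, zero_mul, add_zero]

/-- **Minimizers of the limiting Potts functional are binary (Lemma `lem.limit`, `ε = 0`).**
If `Ω ⊂ ℝ²` has finite positive measure, `K ≥ 2`, the `f_k` are nonnegative and integrable on
`Ω`, `λ > 0`, `σ > 0`, and `u` minimizes `F` over the constraint set `S`, then for a.e.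
`x ∈ Ω`, `u(x) ∈ {0,1}^K`. -/
theorem potts_minimizer_is_binary
    (Ω : Set Plane) (hΩ : MeasurableSet Ω)
    (hΩ0 : 0 < volume Ω) (hΩfin : volume Ω < ⊤)
    (K : ℕ) (hK : 2 ≤ K)
    (f : Fin K → Plane → ℝ)
    (hf_meas : ∀ k, Measurable (f k))
    (hf_int : ∀ k, IntegrableOn (f k) Ω)
    (hf_nonneg : ∀ k, ∀ᵐ x ∂(volume.restrict Ω), 0 ≤ f k x)
    (lam σ : ℝ) (hlam : 0 < lam) (hσ : 0 < σ)
    (u : Fin K → Plane → ℝ) (hu : pottsAdmissible Ω K u)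
    (hmin : ∀ v : Fin K → Plane → ℝ, pottsAdmissible Ω K v →
      pottsF Ω K f lam σ u ≤ pottsF Ω K f lam σ v) :
    ∀ᵐ x ∂(volume.restrict Ω), ∀ k, u k x = 0 ∨ u k x = 1 := by
  have hΩ' : volume Ω ≠ ⊤ := hΩfin.ne
  have hnull : ∀ i j : Fin K, i ≠ j → ∀ n : ℕ, ∀ᵐ x ∂(volume.restrict Ω),
      ¬ ((1 : ℝ) / (n + 1) ≤ u i x ∧ (1 : ℝ) / (n + 1) ≤ u j x) := by
    intro i j hij n
    set δ : ℝ := 1 / (n + 1) with hδ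
    have hδ0 : 0 < δ := by positivity
    have hmeas : MeasurableSet {x | δ ≤ u i x ∧ δ ≤ u j x} :=
      (measurableSet_le measurable_const (hu.1 i)).inter
        (measurableSet_le measurable_const (hu.1 j))
    set A : Set Plane := {x | δ ≤ u i x ∧ δ ≤ u j x} ∩ Ω with hAdef
    have hA : MeasurableSet A := hmeas.inter hΩ
    have hAΩ : A ⊆ Ω := Set.inter_subset_right
    by_contra hne
    have hA0 : volume A ≠ 0 := by
      intro h0
      apply hne
      rw [ae_iff]
      simpa only [not_not, Measure.restrict_apply hmeas] using h0
    have hB := integral_indicator_mul_gaussConv_pos hσ hA hAΩ hA0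
      (measure_ne_top_of_subset hAΩ hΩ')
    set B := ∫ x in Ω, A.indicator 1 x * gaussConv σ (A.indicator 1) x
    let c : Fin K → ℝ := Pi.single i δ - Pi.single j δ
    have hc : ∑ k, c k = 0 := by simp [c, Finset.sum_sub_distrib]
    have hci : c i = δ := by simp [c, hij]
    have habs : ∀ k, ∀ x ∈ A, c k ≠ 0 → |c k| ≤ u k x := by
      intro k x hx hk
      by_cases hki : k = i
      · subst hki
        rw [hci, abs_of_pos hδ0]
        exact hx.1.1
      · by_cases hkj : k = j
        · subst hkj
          have : c k = -δ := by simp [c, hki]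
          rw [this, abs_neg, abs_of_pos hδ0]
          exact hx.1.2
        · exact absurd (by simp [c, hki, hkj]) hk
    have h₁ := hmin _ (hu.add_indicator hA hc fun k x hx hk =>
      (neg_le_abs _).trans (habs k x hx hk.ne))
    have h₂ := hmin _ (hu.add_indicator hA (c := fun k => -c k) (by simp [hc])
      fun k x hx hk => by
        rw [neg_neg]
        exact (le_abs_self _).trans (habs k x hx (by linarith : (0 : ℝ) < c k).ne'))
    have hsum : pottsF Ω K f lam σ (fun k x => u k x + c k * A.indicator 1 x) +
        pottsF Ω K f lam σ (fun k x => u k x + -c k * A.indicator 1 x) =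
        2 * pottsF Ω K f lam σ u - lam * (∑ k, c k ^ 2) * B := by
      change (∑ k, pottsPhase Ω (f k) lam σ (fun x => u k x + c k * A.indicator 1 x)) +
        (∑ k, pottsPhase Ω (f k) lam σ (fun x => u k x + -c k * A.indicator 1 x)) =
        2 * (∑ k, pottsPhase Ω (f k) lam σ (u k)) - _
      rw [← Finset.sum_add_distrib, Finset.mul_sum, Finset.mul_sum, Finset.sum_mul,
        ← Finset.sum_sub_distrib]
      exact Finset.sum_congr rfl fun k _ =>
        pottsPhase_second_difference hΩ hΩ' (hf_int k) hσ (hu.1 k) (hu.2.1 k) (hu.le_one k)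
          hA hAΩ (c k)
    have hcsq : 0 < ∑ k, c k ^ 2 :=
      Finset.sum_pos' (fun k _ => sq_nonneg _) ⟨i, Finset.mem_univ i, by rw [hci]; positivity⟩
    have : 0 < lam * (∑ k, c k ^ 2) * B := by positivity
    linarith
  have hall : ∀ᵐ x ∂(volume.restrict Ω), ∀ i j : Fin K, i ≠ j → ∀ n : ℕ,
      ¬ ((1 : ℝ) / (n + 1) ≤ u i x ∧ (1 : ℝ) / (n + 1) ≤ u j x) := by
    simpa only [ae_all_iff] using hnull
  filter_upwards [hall, ae_all_iff.2 hu.2.1, hu.2.2] with x hx h0 h1 k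
  refine or_iff_not_imp_left.2 fun hk => ?_
  have hkpos : 0 < u k x := lt_of_le_of_ne (h0 k) (Ne.symm hk)
  rw [← h1, Finset.sum_eq_single k _ (by simp)]
  intro j _ hjk
  by_contra hj
  have hjpos : 0 < u j x := lt_of_le_of_ne (h0 j) (Ne.symm hj)
  obtain ⟨n, hn⟩ := exists_nat_one_div_lt (lt_min hkpos hjpos)
  exact hx k j hjk.symm n ⟨(hn.trans_le (min_le_left _ _)).le, (hn.trans_le (min_le_right _ _)).le⟩
end

section
/- With the data of the hybrid splitting scheme (Algorithm 3), the local truncation error is second order: there exist C > 0 and Δt₀ > 0 such that for every 0 < Δt ≤ Δt₀ and every n with (n+1)Δt ≤ T, if one step of the scheme is started from the exact solution value (u^{n+0/M} = u^{n+0/M}_1 = u(t^n)), then the resulting value u^{n+1} satisfies ‖u^{n+1} − u(t^{n+1})‖ ≤ C·Δt². -/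
open Finset

open Asymptotics Filter Topology

/-- The time steps `(Δt, n)` with `Δt → 0⁺` and `(n + 1) Δt ≤ T`, uniformly in `n`. -/
def stepFilter (T : ℝ) : Filter (ℝ × ℕ) :=
  comap Prod.fst (𝓝[>] 0) ⊓ 𝓟 {p | ((p.2 : ℝ) + 1) * p.1 ≤ T}

lemma eventually_stepFilter_iff {T : ℝ} {P : ℝ × ℕ → Prop} :
    (∀ᶠ p in stepFilter T, P p) ↔
      ∃ δ > (0 : ℝ), ∀ h, 0 < h → h < δ → ∀ n : ℕ, ((n : ℝ) + 1) * h ≤ T → P (h, n) := by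
  rw [stepFilter, eventually_inf_principal, eventually_comap, eventually_nhdsWithin_iff,
    Metric.eventually_nhds_iff]
  constructor
  · rintro ⟨δ, hδ, H⟩
    refine ⟨δ, hδ, fun h h0 h1 n hn => ?_⟩
    exact H (by rwa [Real.dist_0_eq_abs, abs_of_pos h0]) h0 (h, n) rfl hn
  · rintro ⟨δ, hδ, H⟩
    refine ⟨δ, hδ, ?_⟩
    rintro h h1 h0 ⟨_, n⟩ rfl hn
    exact H _ h0 (lt_of_le_of_lt (le_abs_self _) (by rwa [Real.dist_0_eq_abs] at h1)) n hn

lemma eventually_stepFilter_times (T : ℝ) :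
    ∀ᶠ p in stepFilter T, 0 < p.1 ∧ (p.2 : ℝ) * p.1 ∈ Set.Icc 0 T ∧
      ((p.2 : ℝ) + 1) * p.1 ∈ Set.Icc 0 T := by
  rw [eventually_stepFilter_iff]
  refine ⟨1, one_pos, fun h h0 _ n hn => ⟨h0, ⟨by positivity, ?_⟩, by positivity, hn⟩⟩
  simp only
  linarith

lemma isBigO_one_fst_stepFilter (T : ℝ) :
    (fun p : ℝ × ℕ => p.1) =O[stepFilter T] (fun _ => (1 : ℝ)) := by
  refine IsBigO.of_bound 1 (eventually_stepFilter_iff.2 ⟨1, one_pos, fun h h0 h1 n _ => ?_⟩)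
  simp [abs_of_pos h0, h1.le]

section Sampling

variable {F : Type*} [NormedAddCommGroup F] {T : ℝ} {g : ℝ → F}

lemma ContinuousOn.isBigO_sample (hg : ContinuousOn g (Set.Icc 0 T)) {τ : ℝ × ℕ → ℝ}
    (hτ : ∀ᶠ p in stepFilter T, τ p ∈ Set.Icc 0 T) :
    (fun p => g (τ p)) =O[stepFilter T] (fun _ => (1 : ℝ)) := by
  obtain ⟨C, hC⟩ := isCompact_Icc.exists_bound_of_continuousOn hg
  refine IsBigO.of_bound C (hτ.mono fun p hp => ?_)
  simpa using hC _ hp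

lemma LipschitzOnWith.isBigO_sample_sub {K : NNReal} (hg : LipschitzOnWith K g (Set.Icc 0 T)) :
    (fun p : ℝ × ℕ => g (((p.2 : ℝ) + 1) * p.1) - g ((p.2 : ℝ) * p.1))
      =O[stepFilter T] (fun p => p.1) := by
  refine IsBigO.of_bound K ((eventually_stepFilter_times T).mono fun p hp => ?_)
  have := hg.norm_sub_le hp.2.2 hp.2.1
  rwa [show ((p.2 : ℝ) + 1) * p.1 - (p.2 : ℝ) * p.1 = p.1 by ring] at this

variable [NormedSpace ℝ F]

/-- First-order Taylor expansion with quadratic remainder. -/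
lemma LipschitzOnWith.isBigO_taylor {u : ℝ → F} {K : NNReal}
    (hg : LipschitzOnWith K g (Set.Icc 0 T)) (hu : ∀ t ∈ Set.Icc 0 T, HasDerivAt u (g t) t) :
    (fun p : ℝ × ℕ => u (((p.2 : ℝ) + 1) * p.1) - u ((p.2 : ℝ) * p.1) -
      p.1 • g ((p.2 : ℝ) * p.1)) =O[stepFilter T] (fun p => p.1 ^ 2) := by
  refine IsBigO.of_bound K ((eventually_stepFilter_times T).mono fun p hp => ?_)
  obtain ⟨h0, ha, hb⟩ := hp
  set a := (p.2 : ℝ) * p.1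
  have hab : ((p.2 : ℝ) + 1) * p.1 = a + p.1 := by simp only [a]; ring
  rw [hab] at hb ⊢
  have hsub : Set.Icc a (a + p.1) ⊆ Set.Icc 0 T := Set.Icc_subset_Icc ha.1 hb.2
  have key := (convex_Icc a (a + p.1)).norm_image_sub_le_of_norm_hasDerivWithin_le
    (f := fun t => u t - t • g a) (f' := fun t => g t - g a) (C := K * p.1)
    (x := a) (y := a + p.1)
    (fun t ht => by
      have h1 := (hasDerivAt_id t).smul_const (g a)
      rw [one_smul] at h1
      exact ((hu t (hsub ht)).sub h1).hasDerivWithinAt)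
    (fun t ht => by
      refine (hg.norm_sub_le (hsub ht) ha).trans ?_
      gcongr
      rw [Real.norm_eq_abs, abs_of_nonneg (by linarith [ht.1])]
      linarith [ht.2])
    ⟨le_rfl, by linarith⟩ ⟨by linarith, le_rfl⟩
  calc _ = ‖u (a + p.1) - (a + p.1) • g a - (u a - a • g a)‖ := by
        congr 1; rw [add_smul]; abel
    _ ≤ _ := key
    _ = _ := by
        rw [add_sub_cancel_left, Real.norm_of_nonneg h0.le, Real.norm_of_nonneg (by positivity)]
        ring

end Sampling

lemma LipschitzOnWith.clm_apply_of_bounded {E F : Type*} [NormedAddCommGroup E] [NormedSpace ℝ E]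
    [NormedAddCommGroup F] [NormedSpace ℝ F] {s : Set ℝ} (hs : IsCompact s) {B : ℝ → E →L[ℝ] F}
    {v : ℝ → E} {K L : NNReal} (hB : LipschitzOnWith K B s) (hv : LipschitzOnWith L v s) :
    ∃ N, LipschitzOnWith N (fun t => B t (v t)) s := by
  obtain ⟨b, hb⟩ := hs.exists_bound_of_continuousOn hB.continuousOn
  obtain ⟨r, hr⟩ := hs.exists_bound_of_continuousOn hv.continuousOn
  refine ⟨(b * L + K * r).toNNReal, LipschitzOnWith.of_dist_le_mul fun x hx y hy => ?_⟩
  have hb0 : 0 ≤ b := (norm_nonneg _).trans (hb x hx)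
  have hr0 : 0 ≤ r := (norm_nonneg _).trans (hr x hx)
  rw [Real.coe_toNNReal _ (by positivity), dist_eq_norm, dist_eq_norm]
  calc ‖B x (v x) - B y (v y)‖ = ‖B x (v x - v y) + (B x - B y) (v y)‖ := by simp
    _ ≤ ‖B x‖ * ‖v x - v y‖ + ‖B x - B y‖ * ‖v y‖ :=
        (norm_add_le _ _).trans (add_le_add ((B x).le_opNorm _) ((B x - B y).le_opNorm _))
    _ ≤ b * (L * ‖x - y‖) + (K * ‖x - y‖) * r := by
        gcongr
        exacts [hb x hx, hv.norm_sub_le hx hy, hB.norm_sub_le hx hy, hr y hy]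
    _ = _ := by ring

lemma LipschitzOnWith.exists_finset_sum {ι F : Type*} [SeminormedAddCommGroup F] {s : Set ℝ}
    (I : Finset ι) {g : ι → ℝ → F} (h : ∀ i ∈ I, ∃ K, LipschitzOnWith K (g i) s) :
    ∃ K, LipschitzOnWith K (fun t => ∑ i ∈ I, g i t) s := by
  classical
  induction I using Finset.induction_on with
  | empty => exact ⟨0, by simpa using LipschitzWith.lipschitzOnWith (LipschitzWith.const (0 : F))⟩
  | insert i I hi ih =>
    obtain ⟨K, hK⟩ := h i (Finset.mem_insert_self _ _)
    obtain ⟨L, hL⟩ := ih fun j hj => h j (Finset.mem_insert_of_mem hj)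
    exact ⟨K + L, by simpa only [Finset.sum_insert hi] using hK.add hL⟩

section Resolvent

variable {d : ℕ} {S : Matrix (Fin d) (Fin d) ℝ} {a : ℝ}

lemma matApp_one_add_smul (S : Matrix (Fin d) (Fin d) ℝ) (a : ℝ) (v : EuclideanSpace ℝ (Fin d)) :
    matApp (1 + a • S) v = v + a • matApp S v := by
  simp [matApp]

lemma matApp_resolvent_add (hS : S.PosDef) (ha : 0 ≤ a) (y : EuclideanSpace ℝ (Fin d)) :
    matApp ((1 + a • S)⁻¹) y + a • matApp S (matApp ((1 + a • S)⁻¹) y) = y := by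
  have hpd : (1 + a • S).PosDef := Matrix.PosDef.one.add_posSemidef (hS.posSemidef.smul ha)
  have hdet : IsUnit (1 + a • S).det := (Matrix.isUnit_iff_isUnit_det _).1 hpd.isUnit
  rw [← matApp_one_add_smul]
  simp only [matApp]
  rw [← mul_apply_eq_comp, ← map_mul, Matrix.mul_nonsing_inv _ hdet, map_one]
  rfl

lemma inner_matApp_nonneg (hS : S.PosDef) (v : EuclideanSpace ℝ (Fin d)) :
    0 ≤ inner ℝ v (matApp S v) := by
  have := hS.posSemidef.dotProduct_mulVec_nonneg (WithLp.ofLp v)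
  simpa [matApp, EuclideanSpace.inner_eq_star_dotProduct, dotProduct_comm] using this

lemma norm_matApp_resolvent_le (hS : S.PosDef) (ha : 0 ≤ a) (y : EuclideanSpace ℝ (Fin d)) :
    ‖matApp ((1 + a • S)⁻¹) y‖ ≤ ‖y‖ := by
  have hx := matApp_resolvent_add hS ha y
  set x := matApp ((1 + a • S)⁻¹) y
  have h1 : ‖x‖ * ‖x‖ ≤ ‖x‖ * ‖y‖ := by
    calc ‖x‖ * ‖x‖ ≤ inner ℝ x x + a * inner ℝ x (matApp S x) := by
          rw [real_inner_self_eq_norm_mul_norm]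
          have := mul_nonneg ha (inner_matApp_nonneg hS x)
          linarith
      _ = inner ℝ x y := by
          rw [← real_inner_smul_right, ← inner_add_right, hx]
      _ ≤ _ := real_inner_le_norm _ _
  by_contra! h
  have : 0 < ‖x‖ := (norm_nonneg _).trans_lt h
  nlinarith

lemma norm_matApp_resolvent_sub_le (hS : S.PosDef) (ha : 0 ≤ a) (y : EuclideanSpace ℝ (Fin d)) :
    ‖matApp ((1 + a • S)⁻¹) y - (y - a • matApp S y)‖ ≤
      a ^ 2 * ‖Matrix.toEuclideanCLM (𝕜 := ℝ) S‖ ^ 2 * ‖y‖ := by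
  have hx := matApp_resolvent_add hS ha y
  have hle := norm_matApp_resolvent_le hS ha y
  set x := matApp ((1 + a • S)⁻¹) y
  set B := Matrix.toEuclideanCLM (𝕜 := ℝ) S
  have hx' : y - x = a • B x := by
    change x + a • B x = y at hx
    exact sub_eq_iff_eq_add'.2 hx.symm
  have h2 : x - (y - a • matApp S y) = a • B (a • B x) := by
    rw [← hx', map_sub, smul_sub, ← hx']
    change x - (y - a • B y) = _
    abel
  rw [h2, map_smul, smul_smul, norm_smul, Real.norm_of_nonneg (by positivity)]
  calc a * a * ‖B (B x)‖ ≤ a * a * (‖B‖ * (‖B‖ * ‖y‖)) := by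
        gcongr
        exact B.le_opNorm_of_le (B.le_opNorm_of_le hle)
    _ = _ := by ring

end Resolvent

section Asymptotics

variable {α : Type*} {l : Filter α} {E F : Type*} [NormedAddCommGroup E] [NormedSpace ℝ E]
  [NormedAddCommGroup F] [NormedSpace ℝ F]

lemma Asymptotics.IsBigO.clm_apply' {B : α → E →L[ℝ] F} {v : α → E} {b r : α → ℝ}
    (hB : B =O[l] b) (hv : v =O[l] r) : (fun x => B x (v x)) =O[l] fun x => b x * r x := by
  refine IsBigO.trans (IsBigO.of_norm_le fun x => ?_) (hB.norm_left.mul hv.norm_left)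
  exact (B x).le_opNorm _

lemma Asymptotics.IsBigO.clm_apply_sub {B B' : α → E →L[ℝ] F} {v v' : α → E} {h : α → ℝ}
    (hB : B =O[l] fun _ => (1 : ℝ)) (hBB' : (fun x => B x - B' x) =O[l] h)
    (hv' : v' =O[l] fun _ => (1 : ℝ)) (hvv' : (fun x => v x - v' x) =O[l] h) :
    (fun x => B x (v x) - B' x (v' x)) =O[l] h := by
  have h1 := (hB.clm_apply' hvv').add ((hBB'.clm_apply' hv').congr_right (g₂ := fun x => 1 * h x)
    fun x => mul_comm _ _)
  simpa using h1

variable {d : ℕ}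

/-- One channel of a substep agrees with an explicit Euler step up to second order. -/
lemma isBigO_channel {h : α → ℝ} (hpos : ∀ᶠ x in l, 0 < h x) (h1 : h =O[l] fun _ => (1 : ℝ))
    (γ : ℝ) (hγ : 0 ≤ γ) {S₁ S₀ : α → Matrix (Fin d) (Fin d) ℝ}
    {U v w w₀ : α → EuclideanSpace ℝ (Fin d)} (hpd : ∀ᶠ x in l, (S₁ x).PosDef)
    (hS : (fun x => Matrix.toEuclideanCLM (𝕜 := ℝ) (S₁ x)) =O[l] fun _ => (1 : ℝ))
    (hSS : (fun x => Matrix.toEuclideanCLM (𝕜 := ℝ) (S₁ x) - Matrix.toEuclideanCLM (𝕜 := ℝ) (S₀ x))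
      =O[l] h)
    (hv : v =O[l] fun _ => (1 : ℝ)) (hU : (fun x => U x - v x) =O[l] h)
    (hw₀ : w₀ =O[l] fun _ => (1 : ℝ)) (hw : (fun x => w x - w₀ x) =O[l] h) :
    (fun x => matApp ((1 + (γ * h x) • S₁ x)⁻¹) (U x - (γ * h x) • w x) -
      (U x - (γ * h x) • (w₀ x + matApp (S₀ x) (v x)))) =O[l] fun x => h x ^ 2 := by
  have hγh : (fun x => γ * h x) =O[l] h := (isBigO_refl h l).const_mul_left γ
  have hw1 : w =O[l] fun _ => (1 : ℝ) := by simpa using (hw.trans h1).add hw₀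
  have hyv : (fun x => U x - (γ * h x) • w x - v x) =O[l] h := by
    have := hU.sub ((hγh.smul hw1).congr_right (g₂ := h) fun x => by simp)
    refine this.congr_left fun x => by abel
  have hy : (fun x => U x - (γ * h x) • w x) =O[l] fun _ => (1 : ℝ) := by
    simpa using (hyv.trans h1).add hv
  have e1 : (fun x => matApp ((1 + (γ * h x) • S₁ x)⁻¹) (U x - (γ * h x) • w x) -
      ((U x - (γ * h x) • w x) - (γ * h x) • matApp (S₁ x) (U x - (γ * h x) • w x)))
      =O[l] fun x => h x ^ 2 := by
    have hb : (fun x => (γ * h x) ^ 2 * ‖Matrix.toEuclideanCLM (𝕜 := ℝ) (S₁ x)‖ ^ 2 *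
        ‖U x - (γ * h x) • w x‖) =O[l] fun x => h x ^ 2 := by
      simpa using ((hγh.pow 2).mul (hS.norm_left.pow 2)).mul hy.norm_left
    refine IsBigO.trans (IsBigO.of_bound 1 ?_) hb
    filter_upwards [hpos, hpd] with x hx hpx
    rw [one_mul, Real.norm_of_nonneg (by positivity)]
    exact norm_matApp_resolvent_sub_le hpx (by positivity) _
  have e2 : (fun x => (γ * h x) • (w x - w₀ x + (matApp (S₁ x) (U x - (γ * h x) • w x) -
      matApp (S₀ x) (v x)))) =O[l] fun x => h x ^ 2 := by
    have := hγh.smul (hw.add (hS.clm_apply_sub hSS hv hyv))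
    exact this.congr_right fun x => by rw [smul_eq_mul, sq]
  refine (e1.sub e2).congr_left fun x => ?_
  simp only [smul_add, smul_sub]
  abel

end Asymptotics

lemma inv_smul_sum_sub {F : Type*} [AddCommGroup F] [Module ℝ F] {n : ℕ} (hn : n ≠ 0) (h : ℝ)
    (x H : ℕ → F) (U : F) :
    (n : ℝ)⁻¹ • ∑ k ∈ Icc 1 n, (x k - (U - ((n : ℝ) * h) • H k)) =
      (n : ℝ)⁻¹ • ∑ k ∈ Icc 1 n, x k - (U - h • ∑ k ∈ Icc 1 n, H k) := by
  have hn' : (n : ℝ) ≠ 0 := Nat.cast_ne_zero.2 hn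
  rw [sum_sub_distrib, sum_sub_distrib, sum_const, Nat.card_Icc, Nat.add_sub_cancel,
    ← smul_sum, smul_sub, smul_sub, ← Nat.cast_smul_eq_nsmul ℝ, inv_smul_smul₀ hn', smul_smul,
    inv_mul_cancel_left₀ hn']

/-- **Second-order local truncation error of the hybrid splitting scheme (Algorithm 3).**
If one step of the scheme is started from the exact solution value `u (n Δt)`, the result
differs from `u ((n+1) Δt)` by at most `C Δt²`. -/
theorem hybrid_splitting_local_truncation_second_order
    (d M : ℕ) (hd : 1 ≤ d) (hM : 1 ≤ M) (T : ℝ) (hT : 0 < T)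
    (c : ℕ → ℕ) (hc0 : c 0 = 1) (hc : ∀ m, 1 ≤ m → m ≤ M → 1 ≤ c m)
    (A : ℕ → ℕ → ℕ → ℝ → Matrix (Fin d) (Fin d) ℝ)
    (S : ℕ → ℕ → ℝ → Matrix (Fin d) (Fin d) ℝ)
    (f : ℕ → ℕ → ℝ → EuclideanSpace ℝ (Fin d))
    (LA LS Lf : NNReal)
    (hA_lip : ∀ m ∈ Finset.Icc 1 M, ∀ k ∈ Finset.Icc 1 (c m), ∀ s ∈ Finset.Icc 1 (c (m - 1)),
      LipschitzOnWith LA (fun t => Matrix.toEuclideanCLM (𝕜 := ℝ) (A m k s t)) (Set.Icc 0 T))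
    (hA_pd : ∀ m ∈ Finset.Icc 1 M, ∀ k ∈ Finset.Icc 1 (c m), ∀ s ∈ Finset.Icc 1 (c (m - 1)),
      ∀ t ∈ Set.Icc (0 : ℝ) T, (A m k s t).PosDef)
    (hS_lip : ∀ m ∈ Finset.Icc 1 M, ∀ k ∈ Finset.Icc 1 (c m),
      LipschitzOnWith LS (fun t => Matrix.toEuclideanCLM (𝕜 := ℝ) (S m k t)) (Set.Icc 0 T))
    (hS_pd : ∀ m ∈ Finset.Icc 1 M, ∀ k ∈ Finset.Icc 1 (c m),
      ∀ t ∈ Set.Icc (0 : ℝ) T, (S m k t).PosDef)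
    (hf_lip : ∀ m ∈ Finset.Icc 1 M, ∀ k ∈ Finset.Icc 1 (c m),
      LipschitzOnWith Lf (f m k) (Set.Icc 0 T))
    (u0 : EuclideanSpace ℝ (Fin d)) (u : ℝ → EuclideanSpace ℝ (Fin d))
    (hu0 : u 0 = u0)
    (hu : ∀ t ∈ Set.Icc (0 : ℝ) T, HasDerivAt u
      (-(∑ m ∈ Finset.Icc 1 M,
          ((∑ k ∈ Finset.Icc 1 (c m), ∑ s ∈ Finset.Icc 1 (c (m - 1)),
              matApp (A m k s t) (u t))
            + (∑ k ∈ Finset.Icc 1 (c m), matApp (S m k t) (u t))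
            + ∑ k ∈ Finset.Icc 1 (c m), f m k t))) t) :
    ∃ C > (0 : ℝ), ∃ Δt₀ > (0 : ℝ), ∀ Δt : ℝ, 0 < Δt → Δt ≤ Δt₀ → ∀ n : ℕ,
      ((n : ℝ) + 1) * Δt ≤ T →
      ‖(hybridSub d c A S f Δt ((n : ℝ) * Δt) (((n : ℝ) + 1) * Δt) (u ((n : ℝ) * Δt)) M).1
          - u (((n : ℝ) + 1) * Δt)‖ ≤ C * Δt ^ 2 := by
  have hu' : ∀ t ∈ Set.Icc 0 T, HasDerivAt u (-(∑ m ∈ Icc 1 M, ∑ k ∈ Icc 1 (c m),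
      ((∑ s ∈ Icc 1 (c (m - 1)), matApp (A m k s t) (u t)) + f m k t +
        matApp (S m k t) (u t)))) t := by
    intro t ht
    convert hu t ht using 4
    rw [sum_add_distrib, sum_add_distrib]
    abel
  have huc : ContinuousOn u (Set.Icc 0 T) := fun t ht => (hu t ht).continuousAt.continuousWithinAt
  obtain ⟨Lu, hLu⟩ : ∃ K, LipschitzOnWith K u (Set.Icc 0 T) := by
    have hcont : ContinuousOn (fun t => -(∑ m ∈ Icc 1 M, ∑ k ∈ Icc 1 (c m),
        ((∑ s ∈ Icc 1 (c (m - 1)), matApp (A m k s t) (u t)) + f m k t +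
          matApp (S m k t) (u t)))) (Set.Icc 0 T) :=
      (continuousOn_finsetSum _ fun m hm => continuousOn_finsetSum _ fun k hk =>
        ((continuousOn_finsetSum _ fun s hs =>
          (hA_lip m hm k hk s hs).continuousOn.clm_apply huc).add
            (hf_lip m hm k hk).continuousOn).add
          ((hS_lip m hm k hk).continuousOn.clm_apply huc)).neg
    obtain ⟨B, hB⟩ := isCompact_Icc.exists_bound_of_continuousOn hcont
    refine ⟨B.toNNReal, (convex_Icc 0 T).lipschitzOnWith_of_nnnorm_hasDerivWithin_le
      (fun t ht => (hu' t ht).hasDerivWithinAt) fun t ht => ?_⟩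
    rw [← norm_toNNReal]
    exact Real.toNNReal_le_toNNReal (hB t ht)
  have hwl : ∀ m ∈ Icc 1 M, ∀ k ∈ Icc 1 (c m), ∃ K, LipschitzOnWith K (fun t =>
      (∑ s ∈ Icc 1 (c (m - 1)), matApp (A m k s t) (u t)) + f m k t) (Set.Icc 0 T) := by
    intro m hm k hk
    obtain ⟨K, hK⟩ := LipschitzOnWith.exists_finset_sum (s := Set.Icc 0 T) (Icc 1 (c (m - 1)))
      (g := fun s t => matApp (A m k s t) (u t)) fun s hs =>
        (hA_lip m hm k hk s hs).clm_apply_of_bounded isCompact_Icc hLu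
    exact ⟨_, hK.add (hf_lip m hm k hk)⟩
  obtain ⟨K, hK⟩ := LipschitzOnWith.exists_finset_sum (s := Set.Icc 0 T) (Icc 1 M)
    (g := fun m t => ∑ k ∈ Icc 1 (c m), ((∑ s ∈ Icc 1 (c (m - 1)), matApp (A m k s t) (u t)) +
      f m k t + matApp (S m k t) (u t))) fun m hm =>
    LipschitzOnWith.exists_finset_sum _ fun k hk => by
      obtain ⟨K₁, h₁⟩ := hwl m hm k hk
      obtain ⟨K₂, h₂⟩ := (hS_lip m hm k hk).clm_apply_of_bounded isCompact_Icc hLu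
      exact ⟨_, h₁.add h₂⟩
  have htaylor := LipschitzOnWith.isBigO_taylor hK.neg hu'
  simp only [Pi.neg_apply, smul_neg] at htaylor
  have htimes := eventually_stepFilter_times T
  have ht₀ := htimes.mono fun p hp => hp.2.1
  have ht₁ := htimes.mono fun p hp => hp.2.2
  have hfst := isBigO_one_fst_stepFilter T
  have hun := huc.isBigO_sample ht₀
  have hmain : ∀ m ≤ M,
      ((fun p : ℝ × ℕ => (hybridSub d c A S f p.1 ((p.2 : ℝ) * p.1) (((p.2 : ℝ) + 1) * p.1)
          (u ((p.2 : ℝ) * p.1)) m).1 - (u ((p.2 : ℝ) * p.1) - p.1 • ∑ j ∈ Icc 1 m,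
          ∑ k ∈ Icc 1 (c j), ((∑ s ∈ Icc 1 (c (j - 1)),
            matApp (A j k s ((p.2 : ℝ) * p.1)) (u ((p.2 : ℝ) * p.1))) + f j k ((p.2 : ℝ) * p.1) +
            matApp (S j k ((p.2 : ℝ) * p.1)) (u ((p.2 : ℝ) * p.1)))))
        =O[stepFilter T] fun p => p.1 ^ 2) ∧
      ∀ k ∈ Icc 1 (c m), (fun p : ℝ × ℕ => (hybridSub d c A S f p.1 ((p.2 : ℝ) * p.1)
          (((p.2 : ℝ) + 1) * p.1) (u ((p.2 : ℝ) * p.1)) m).2 k - u ((p.2 : ℝ) * p.1))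
        =O[stepFilter T] fun p => p.1 := by
    intro m
    induction m with
    | zero =>
      refine fun _ => ⟨?_, fun k _ => ?_⟩
      · simpa [hybridSub] using isBigO_zero _ _
      · simpa [hybridSub] using isBigO_zero _ _
    | succ m ih =>
      intro hm
      obtain ⟨iha, ihb⟩ := ih (by omega)
      have hm' : m + 1 ∈ Icc 1 M := Finset.mem_Icc.2 ⟨by omega, hm⟩
      have hcm : c (m + 1) ≠ 0 := Nat.one_le_iff_ne_zero.1 (hc (m + 1) (by omega) hm)
      have hsq : (fun p : ℝ × ℕ => p.1 ^ 2) =O[stepFilter T] fun p => p.1 := by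
        simpa [sq] using (isBigO_refl (fun p : ℝ × ℕ => p.1) (stepFilter T)).mul hfst
      have hgen : ∀ j ∈ Icc 1 M, ∀ k ∈ Icc 1 (c j), (fun p : ℝ × ℕ =>
          (∑ s ∈ Icc 1 (c (j - 1)), matApp (A j k s ((p.2 : ℝ) * p.1)) (u ((p.2 : ℝ) * p.1))) +
            f j k ((p.2 : ℝ) * p.1)) =O[stepFilter T] fun _ => (1 : ℝ) := by
        intro j hj k hk
        obtain ⟨_, h⟩ := hwl j hj k hk
        exact h.continuousOn.isBigO_sample ht₀
      have hSu : ∀ j ∈ Icc 1 M, ∀ k ∈ Icc 1 (c j), (fun p : ℝ × ℕ =>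
          matApp (S j k ((p.2 : ℝ) * p.1)) (u ((p.2 : ℝ) * p.1)))
            =O[stepFilter T] fun _ => (1 : ℝ) := fun j hj k hk =>
        ((hS_lip j hj k hk).continuousOn.clm_apply huc).isBigO_sample ht₀
      have hU : (fun p : ℝ × ℕ => (hybridSub d c A S f p.1 ((p.2 : ℝ) * p.1)
          (((p.2 : ℝ) + 1) * p.1) (u ((p.2 : ℝ) * p.1)) m).1 - u ((p.2 : ℝ) * p.1))
          =O[stepFilter T] fun p => p.1 := by
        have hsum := IsBigO.fun_sum (s := Icc 1 m) fun j hj => IsBigO.fun_sum (s := Icc 1 (c j))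
          fun k hk =>
            have hj' : j ∈ Icc 1 M := Finset.Icc_subset_Icc_right (by omega) hj
            (hgen j hj' k hk).add (hSu j hj' k hk)
        have := (iha.trans hsq).sub
          (((isBigO_refl (fun p : ℝ × ℕ => p.1) (stepFilter T)).smul hsum).congr_right
            (g₂ := fun p => p.1) fun p => by simp)
        refine this.congr_left fun p => ?_
        abel
      have hchan : ∀ k ∈ Icc 1 (c (m + 1)), (fun p : ℝ × ℕ =>
          (hybridSub d c A S f p.1 ((p.2 : ℝ) * p.1) (((p.2 : ℝ) + 1) * p.1)
            (u ((p.2 : ℝ) * p.1)) (m + 1)).2 k -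
          ((hybridSub d c A S f p.1 ((p.2 : ℝ) * p.1) (((p.2 : ℝ) + 1) * p.1)
            (u ((p.2 : ℝ) * p.1)) m).1 - ((c (m + 1) : ℝ) * p.1) •
            ((∑ s ∈ Icc 1 (c m), matApp (A (m + 1) k s ((p.2 : ℝ) * p.1)) (u ((p.2 : ℝ) * p.1))) +
              f (m + 1) k ((p.2 : ℝ) * p.1) +
              matApp (S (m + 1) k ((p.2 : ℝ) * p.1)) (u ((p.2 : ℝ) * p.1)))))
          =O[stepFilter T] fun p => p.1 ^ 2 := by
        intro k hk
        refine isBigO_channel (htimes.mono fun p hp => hp.1) hfst _ (Nat.cast_nonneg _)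
          (ht₁.mono fun p hp => hS_pd _ hm' k hk _ hp)
          ((hS_lip _ hm' k hk).continuousOn.isBigO_sample ht₁)
          (hS_lip _ hm' k hk).isBigO_sample_sub hun hU (hgen _ hm' k hk) ?_
        have := IsBigO.fun_sum (s := Icc 1 (c m)) fun s hs =>
          (((hA_lip _ hm' k hk s hs).continuousOn.isBigO_sample ht₀).clm_apply'
            (ihb s hs)).congr_right (g₂ := fun p => p.1) fun p => one_mul _
        refine this.congr_left fun p => ?_
        simp only [map_sub, matApp]
        simp
      refine ⟨?_, fun k hk => ?_⟩
      · have := ((IsBigO.fun_sum hchan).const_smul_left ((c (m + 1) : ℝ)⁻¹)).add iha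
        refine this.congr_left fun p => ?_
        rw [Pi.smul_apply, inv_smul_sum_sub hcm, sum_Icc_succ_top (by omega), smul_add]
        simp only [Nat.add_sub_cancel, hybridSub]
        abel
      · have := ((hchan k hk).trans hsq).add (hU.sub
          ((((isBigO_refl (fun p : ℝ × ℕ => p.1) (stepFilter T)).const_mul_left
            (c (m + 1) : ℝ)).smul ((hgen _ hm' k hk).add (hSu _ hm' k hk))).congr_right
            (g₂ := fun p => p.1) fun p => by simp))
        refine this.congr_left fun p => ?_
        simp only [Nat.add_sub_cancel]
        abel
  obtain ⟨C, hC, hbound⟩ := ((hmain M le_rfl).1.sub htaylor).exists_pos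
  obtain ⟨δ, hδ, H⟩ := eventually_stepFilter_iff.1 hbound.bound
  refine ⟨C, hC, δ / 2, by positivity, fun h h0 h1 n hn => ?_⟩
  have := H h h0 (by linarith) n hn
  rw [Real.norm_of_nonneg (by positivity)] at this
  refine le_of_eq_of_le (congrArg _ ?_) this
  abel
end

section
/- With the data of the hybrid splitting scheme (Algorithm 3), for every R > 0 there exist C > 0 and Δt₀ > 0 such that for every 0 < Δt ≤ Δt₀, every n with (n+1)Δt ≤ T, every starting value u^n with ‖u^n‖ ≤ R, and every 1 ≤ m* ≤ M, the substep average produced by the scheme satisfies ‖ u^{n+m*/M} − ( u^n − Δt Σ_{m=1}^{m*} Σ_{k=1}^{c_m} [ ( Σ_{s=1}^{c_{m−1}} A^m_{k,s}(t^n) + S^m_k(t^{n+1}) ) u^n + f^m_k(t^n) ] ) ‖ ≤ C·Δt². -/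
open Finset

theorem norm_matApp_le {d : ℕ} {A : Matrix (Fin d) (Fin d) ℝ} {B : ℝ}
    (hA : ‖Matrix.toEuclideanCLM (𝕜 := ℝ) A‖ ≤ B) (v : EuclideanSpace ℝ (Fin d)) :
    ‖matApp A v‖ ≤ B * ‖v‖ :=
  (Matrix.toEuclideanCLM (𝕜 := ℝ) A).le_of_opNorm_le hA v

theorem matApp_sub {d : ℕ} (A : Matrix (Fin d) (Fin d) ℝ) (v w : EuclideanSpace ℝ (Fin d)) :
    matApp A (v - w) = matApp A v - matApp A w :=
  map_sub (Matrix.toEuclideanCLM (𝕜 := ℝ) A) v w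

/-- `I + τ S` is expansive when `S` is positive semidefinite and `τ ≥ 0`. -/
theorem Matrix.PosSemidef.norm_le_norm_add_smul_matApp {d : ℕ} {S : Matrix (Fin d) (Fin d) ℝ}
    (hS : S.PosSemidef) {τ : ℝ} (hτ : 0 ≤ τ) (x : EuclideanSpace ℝ (Fin d)) :
    ‖x‖ ≤ ‖x + τ • matApp S x‖ := by
  have hpos : 0 ≤ inner ℝ x (matApp S x) :=
    (Matrix.isPositive_toEuclideanLin_iff.mpr hS).inner_nonneg_right x
  have hsq : ‖x + τ • matApp S x‖ ^ 2
      = ‖x‖ ^ 2 + 2 * (τ * inner ℝ x (matApp S x)) + ‖τ • matApp S x‖ ^ 2 := by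
    rw [norm_add_sq_real, real_inner_smul_right]
  refine le_of_sq_le_sq ?_ (norm_nonneg _)
  nlinarith [mul_nonneg hτ hpos, sq_nonneg ‖τ • matApp S x‖]

/-- The resolvent of a positive definite matrix solves the implicit Euler equation. -/
theorem Matrix.PosDef.matApp_resolvent {d : ℕ} {S : Matrix (Fin d) (Fin d) ℝ}
    (hS : S.PosDef) {τ : ℝ} (hτ : 0 ≤ τ) (w : EuclideanSpace ℝ (Fin d)) :
    matApp ((1 + τ • S)⁻¹) w + τ • matApp S (matApp ((1 + τ • S)⁻¹) w) = w := by
  have hunit : IsUnit (1 + τ • S) :=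
    (Matrix.PosDef.one.add_posSemidef (hS.posSemidef.smul hτ)).isUnit
  have hmul : (1 + τ • S) * (1 + τ • S)⁻¹ = 1 :=
    Matrix.mul_nonsing_inv _ ((Matrix.isUnit_iff_isUnit_det _).mp hunit)
  have happ := congrArg (fun Q => Matrix.toEuclideanCLM (𝕜 := ℝ) Q w) hmul
  simpa [matApp, add_mul] using happ

/-- Zeroth-order estimate for one semi-implicit channel update. -/
theorem norm_resolvent_sub_le {d : ℕ} {S : Matrix (Fin d) (Fin d) ℝ} (hS : S.PosDef) {B : ℝ}
    (hB : ‖Matrix.toEuclideanCLM (𝕜 := ℝ) S‖ ≤ B) {τ : ℝ} (hτ : 0 ≤ τ)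
    (p u g : EuclideanSpace ℝ (Fin d)) :
    ‖matApp ((1 + τ • S)⁻¹) (p - τ • g) - u‖ ≤ ‖p - u‖ + τ * (‖g‖ + B * ‖u‖) := by
  have hv := hS.matApp_resolvent hτ (p - τ • g)
  set v := matApp ((1 + τ • S)⁻¹) (p - τ • g)
  have heq : (v - u) + τ • matApp S (v - u) = (p - u) - τ • (g + matApp S u) := by
    rw [matApp_sub, smul_sub, smul_add]
    linear_combination (norm := module) (1 : ℝ) • hv
  calc ‖v - u‖ ≤ ‖(v - u) + τ • matApp S (v - u)‖ :=
        hS.posSemidef.norm_le_norm_add_smul_matApp hτ _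
    _ = ‖(p - u) - τ • (g + matApp S u)‖ := by rw [heq]
    _ ≤ ‖p - u‖ + ‖τ • (g + matApp S u)‖ := norm_sub_le _ _
    _ = ‖p - u‖ + τ * ‖g + matApp S u‖ := by rw [norm_smul, Real.norm_of_nonneg hτ]
    _ ≤ ‖p - u‖ + τ * (‖g‖ + B * ‖u‖) := by
        gcongr
        exact (norm_add_le _ _).trans (by gcongr; exact norm_matApp_le hB u)

/-- First-order estimate for one semi-implicit channel update. -/
theorem norm_resolvent_sub_explicit_le {d : ℕ} {S : Matrix (Fin d) (Fin d) ℝ} (hS : S.PosDef)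
    {B : ℝ} (hB : ‖Matrix.toEuclideanCLM (𝕜 := ℝ) S‖ ≤ B) {τ : ℝ} (hτ : 0 ≤ τ)
    (p u g g₀ : EuclideanSpace ℝ (Fin d)) :
    ‖matApp ((1 + τ • S)⁻¹) (p - τ • g) - (p - τ • (g₀ + matApp S u))‖
      ≤ τ * (B * ‖matApp ((1 + τ • S)⁻¹) (p - τ • g) - u‖ + ‖g - g₀‖) := by
  have hv := hS.matApp_resolvent hτ (p - τ • g)
  set v := matApp ((1 + τ • S)⁻¹) (p - τ • g)
  have heq : v - (p - τ • (g₀ + matApp S u)) = -(τ • (matApp S (v - u) + (g - g₀))) := by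
    rw [matApp_sub, smul_add, smul_add, smul_sub, smul_sub]
    linear_combination (norm := module) (1 : ℝ) • hv
  rw [heq, norm_neg, norm_smul, Real.norm_of_nonneg hτ]
  gcongr
  exact (norm_add_le _ _).trans (by gcongr; exact norm_matApp_le hB _)

theorem norm_average_sub_le {E : Type*} [SeminormedAddCommGroup E] [NormedSpace ℝ E] {c : ℕ}
    (hc : 1 ≤ c) {v y : ℕ → E} {r : ℝ} (h : ∀ k ∈ Finset.Icc 1 c, ‖v k - y k‖ ≤ r) :
    ‖(c : ℝ)⁻¹ • ∑ k ∈ Finset.Icc 1 c, v k - (c : ℝ)⁻¹ • ∑ k ∈ Finset.Icc 1 c, y k‖ ≤ r := by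
  have hc' : (0 : ℝ) < c := by exact_mod_cast hc
  rw [← smul_sub, ← Finset.sum_sub_distrib, norm_smul, norm_inv, Real.norm_of_nonneg hc'.le,
    inv_mul_le_iff₀ hc']
  simpa using norm_sum_le_of_le _ h

theorem average_const {E : Type*} [AddCommGroup E] [Module ℝ E] {c : ℕ} (hc : 1 ≤ c) (x : E) :
    (c : ℝ)⁻¹ • ∑ _k ∈ Finset.Icc 1 c, x = x := by
  have hc' : (c : ℝ) ≠ 0 := by positivity
  rw [Finset.sum_const, Nat.card_Icc, Nat.add_sub_cancel, ← Nat.cast_smul_eq_nsmul ℝ,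
    inv_smul_smul₀ hc']

/-- Substep expansion with a constant depending only on the channel numbers, the radius `R` and
a common bound `B` for the data at the two time levels. -/
theorem exists_hybridSub_expansion_bound (d : ℕ) (c : ℕ → ℕ) {B R : ℝ} (hB : 0 ≤ B)
    (hR : 0 ≤ R) (m : ℕ) (hc : ∀ j ∈ Finset.Icc 1 m, 1 ≤ c j) :
    ∃ C : ℝ, 0 ≤ C ∧ ∀ (A : ℕ → ℕ → ℕ → ℝ → Matrix (Fin d) (Fin d) ℝ)
      (S : ℕ → ℕ → ℝ → Matrix (Fin d) (Fin d) ℝ)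
      (f : ℕ → ℕ → ℝ → EuclideanSpace ℝ (Fin d)) (Δt tn tn1 : ℝ), 0 ≤ Δt → Δt ≤ 1 →
      (∀ j ∈ Finset.Icc 1 m, ∀ k ∈ Finset.Icc 1 (c j), ∀ s ∈ Finset.Icc 1 (c (j - 1)),
        ‖Matrix.toEuclideanCLM (𝕜 := ℝ) (A j k s tn)‖ ≤ B) →
      (∀ j ∈ Finset.Icc 1 m, ∀ k ∈ Finset.Icc 1 (c j),
        ‖Matrix.toEuclideanCLM (𝕜 := ℝ) (S j k tn1)‖ ≤ B) →
      (∀ j ∈ Finset.Icc 1 m, ∀ k ∈ Finset.Icc 1 (c j), (S j k tn1).PosDef) →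
      (∀ j ∈ Finset.Icc 1 m, ∀ k ∈ Finset.Icc 1 (c j), ‖f j k tn‖ ≤ B) →
      ∀ un : EuclideanSpace ℝ (Fin d), ‖un‖ ≤ R →
      ‖(hybridSub d c A S f Δt tn tn1 un m).1
          - (un - Δt • ∑ j ∈ Finset.Icc 1 m, ∑ k ∈ Finset.Icc 1 (c j),
              (((∑ s ∈ Finset.Icc 1 (c (j - 1)), matApp (A j k s tn) un)
                  + matApp (S j k tn1) un) + f j k tn))‖ ≤ C * Δt ^ 2 ∧
      ‖(hybridSub d c A S f Δt tn tn1 un m).1 - un‖ ≤ C * Δt ∧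
      ∀ k ∈ Finset.Icc 1 (c m), ‖(hybridSub d c A S f Δt tn tn1 un m).2 k - un‖ ≤ C * Δt := by
  induction m with
  | zero => exact ⟨0, le_rfl, by simp [hybridSub]⟩
  | succ m ih =>
    have hsub : Finset.Icc 1 m ⊆ Finset.Icc 1 (m + 1) :=
      Finset.Icc_subset_Icc_right m.le_succ
    have hlast : m + 1 ∈ Finset.Icc 1 (m + 1) := by simp
    obtain ⟨C, hC, ih⟩ := ih fun j hj => hc j (hsub hj)
    have hcm := hc _ hlast
    have hcm' : (c (m + 1) : ℝ) ≠ 0 := by positivity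
    set D : ℝ := C + c (m + 1) * (c m * (B * (R + C)) + B + B * R)
    set F : ℝ := c (m + 1) * (B * D + c m * (B * C))
    have hD : 0 ≤ D := by positivity
    have hF : 0 ≤ F := by positivity
    refine ⟨C + D + F, by positivity, ?_⟩
    intro A S f Δt tn tn1 hΔ hΔ1 hA hS hSpd hf un hun
    obtain ⟨ih_exp, ih_avg, ih_chan⟩ := ih A S f Δt tn tn1 hΔ hΔ1
      (fun j hj => hA j (hsub hj)) (fun j hj => hS j (hsub hj))
      (fun j hj => hSpd j (hsub hj)) (fun j hj => hf j (hsub hj)) un hun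
    have hA := hA _ hlast
    rw [Nat.add_sub_cancel] at hA
    rw [Finset.sum_Icc_succ_top (by omega), Nat.add_sub_cancel]
    simp only [hybridSub]
    set prev := hybridSub d c A S f Δt tn tn1 un m
    set τ : ℝ := c (m + 1) * Δt
    have hτ : 0 ≤ τ := by positivity
    set g : ℕ → EuclideanSpace ℝ (Fin d) := fun k =>
      (∑ s ∈ Finset.Icc 1 (c m), matApp (A (m + 1) k s tn) (prev.2 s)) + f (m + 1) k tn
    set g₀ : ℕ → EuclideanSpace ℝ (Fin d) := fun k =>
      (∑ s ∈ Finset.Icc 1 (c m), matApp (A (m + 1) k s tn) un) + f (m + 1) k tn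
    set v : ℕ → EuclideanSpace ℝ (Fin d) := fun k =>
      matApp ((1 + τ • S (m + 1) k tn1)⁻¹) (prev.1 - τ • g k)
    set X : ℕ → EuclideanSpace ℝ (Fin d) := fun k => g₀ k + matApp (S (m + 1) k tn1) un
    have hprev : ∀ s ∈ Finset.Icc 1 (c m), ‖prev.2 s‖ ≤ R + C := fun s hs =>
      calc ‖prev.2 s‖ ≤ ‖un‖ + ‖prev.2 s - un‖ := norm_le_norm_add_norm_sub' _ _
        _ ≤ R + C := add_le_add hun ((ih_chan s hs).trans (mul_le_of_le_one_right hC hΔ1))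
    have hg : ∀ k ∈ Finset.Icc 1 (c (m + 1)), ‖g k‖ ≤ c m * (B * (R + C)) + B := by
      intro k hk
      refine (norm_add_le _ _).trans (add_le_add ?_ (hf _ hlast k hk))
      have hsum : ∀ s ∈ Finset.Icc 1 (c m),
          ‖matApp (A (m + 1) k s tn) (prev.2 s)‖ ≤ B * (R + C) := fun s hs =>
        (norm_matApp_le (hA k hk s hs) _).trans
          (mul_le_mul_of_nonneg_left (hprev s hs) hB)
      simpa using norm_sum_le_of_le _ hsum
    have hgg : ∀ k ∈ Finset.Icc 1 (c (m + 1)), ‖g k - g₀ k‖ ≤ c m * (B * (C * Δt)) := by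
      intro k hk
      have hsum : ∀ s ∈ Finset.Icc 1 (c m),
          ‖matApp (A (m + 1) k s tn) (prev.2 s) - matApp (A (m + 1) k s tn) un‖
            ≤ B * (C * Δt) := fun s hs => by
        rw [← matApp_sub]
        exact (norm_matApp_le (hA k hk s hs) _).trans
          (mul_le_mul_of_nonneg_left (ih_chan s hs) hB)
      simpa [g, g₀, ← Finset.sum_sub_distrib] using norm_sum_le_of_le _ hsum
    have hchan : ∀ k ∈ Finset.Icc 1 (c (m + 1)), ‖v k - un‖ ≤ D * Δt := fun k hk =>
      calc ‖v k - un‖ ≤ ‖prev.1 - un‖ + τ * (‖g k‖ + B * ‖un‖) :=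
            norm_resolvent_sub_le (hSpd _ hlast k hk) (hS _ hlast k hk) hτ _ _ _
        _ ≤ C * Δt + τ * (c m * (B * (R + C)) + B + B * R) := by
            gcongr
            exact hg k hk
        _ = D * Δt := by ring
    have hexp : ∀ k ∈ Finset.Icc 1 (c (m + 1)),
        ‖v k - (prev.1 - τ • X k)‖ ≤ F * Δt ^ 2 := fun k hk =>
      calc ‖v k - (prev.1 - τ • X k)‖ ≤ τ * (B * ‖v k - un‖ + ‖g k - g₀ k‖) :=
            norm_resolvent_sub_explicit_le (hSpd _ hlast k hk) (hS _ hlast k hk) hτ _ _ _ _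
        _ ≤ τ * (B * (D * Δt) + c m * (B * (C * Δt))) := by
            gcongr
            · exact hchan k hk
            · exact hgg k hk
        _ = F * Δt ^ 2 := by ring
    have havg := norm_average_sub_le hcm hchan
    rw [average_const hcm] at havg
    have hexp_avg := norm_average_sub_le hcm hexp
    rw [Finset.sum_sub_distrib, smul_sub, average_const hcm, ← Finset.smul_sum, smul_smul,
      inv_mul_cancel_left₀ hcm'] at hexp_avg
    have hX : ∑ k ∈ Finset.Icc 1 (c (m + 1)),
        (((∑ s ∈ Finset.Icc 1 (c m), matApp (A (m + 1) k s tn) un)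
          + matApp (S (m + 1) k tn1) un) + f (m + 1) k tn)
        = ∑ k ∈ Finset.Icc 1 (c (m + 1)), X k :=
      Finset.sum_congr rfl fun k _ => add_right_comm _ _ _
    have hDle : D * Δt ≤ (C + D + F) * Δt := by
      gcongr
      linarith
    refine ⟨?_, havg.trans hDle, fun k hk => (hchan k hk).trans hDle⟩
    rw [hX, smul_add]
    set G := Δt • ∑ j ∈ Finset.Icc 1 m, ∑ k ∈ Finset.Icc 1 (c j),
      (((∑ s ∈ Finset.Icc 1 (c (j - 1)), matApp (A j k s tn) un)
        + matApp (S j k tn1) un) + f j k tn)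
    calc _ = ‖((c (m + 1) : ℝ)⁻¹ • ∑ k ∈ Finset.Icc 1 (c (m + 1)), v k
              - (prev.1 - Δt • ∑ k ∈ Finset.Icc 1 (c (m + 1)), X k))
            + (prev.1 - (un - G))‖ := by congr 1; abel
      _ ≤ F * Δt ^ 2 + C * Δt ^ 2 := norm_add_le_of_le hexp_avg ih_exp
      _ ≤ (C + D + F) * Δt ^ 2 := by nlinarith [mul_nonneg hD (sq_nonneg Δt)]

theorem LipschitzOnWith.eventually_norm_le {E : Type*} [SeminormedAddCommGroup E] {K : NNReal}
    {g : ℝ → E} {T : ℝ} (hg : LipschitzOnWith K g (Set.Icc 0 T)) :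
    ∀ᶠ B : ℝ in Filter.atTop, ∀ t ∈ Set.Icc 0 T, ‖g t‖ ≤ B := by
  obtain ⟨B₀, hB₀⟩ := isCompact_Icc.exists_bound_of_continuousOn hg.continuousOn
  filter_upwards [Filter.eventually_ge_atTop B₀] with B hB t ht
  exact (hB₀ t ht).trans hB

/-- **Second-order accuracy of the substep averages of the hybrid splitting scheme
(equations (\ref{eq.hybrid.proof.induction2}) in the proof of Theorem `thm.hybrid`).**
For bounded starting values `u^n` the substep average `u^{n+m*/M}` agrees with its explicit
first-order expansion up to `C Δt²`. -/
theorem hybrid_splitting_substep_expansion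
    (d M : ℕ) (hd : 1 ≤ d) (hM : 1 ≤ M) (T : ℝ) (hT : 0 < T)
    (c : ℕ → ℕ) (hc0 : c 0 = 1) (hc : ∀ m, 1 ≤ m → m ≤ M → 1 ≤ c m)
    (A : ℕ → ℕ → ℕ → ℝ → Matrix (Fin d) (Fin d) ℝ)
    (S : ℕ → ℕ → ℝ → Matrix (Fin d) (Fin d) ℝ)
    (f : ℕ → ℕ → ℝ → EuclideanSpace ℝ (Fin d))
    (LA LS Lf : NNReal)
    (hA_lip : ∀ m ∈ Finset.Icc 1 M, ∀ k ∈ Finset.Icc 1 (c m), ∀ s ∈ Finset.Icc 1 (c (m - 1)),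
      LipschitzOnWith LA (fun t => Matrix.toEuclideanCLM (𝕜 := ℝ) (A m k s t)) (Set.Icc 0 T))
    (hA_pd : ∀ m ∈ Finset.Icc 1 M, ∀ k ∈ Finset.Icc 1 (c m), ∀ s ∈ Finset.Icc 1 (c (m - 1)),
      ∀ t ∈ Set.Icc (0 : ℝ) T, (A m k s t).PosDef)
    (hS_lip : ∀ m ∈ Finset.Icc 1 M, ∀ k ∈ Finset.Icc 1 (c m),
      LipschitzOnWith LS (fun t => Matrix.toEuclideanCLM (𝕜 := ℝ) (S m k t)) (Set.Icc 0 T))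
    (hS_pd : ∀ m ∈ Finset.Icc 1 M, ∀ k ∈ Finset.Icc 1 (c m),
      ∀ t ∈ Set.Icc (0 : ℝ) T, (S m k t).PosDef)
    (hf_lip : ∀ m ∈ Finset.Icc 1 M, ∀ k ∈ Finset.Icc 1 (c m),
      LipschitzOnWith Lf (f m k) (Set.Icc 0 T))
    (R : ℝ) (hR : 0 < R) :
    ∃ C > (0 : ℝ), ∃ Δt₀ > (0 : ℝ), ∀ Δt : ℝ, 0 < Δt → Δt ≤ Δt₀ → ∀ n : ℕ,
      ((n : ℝ) + 1) * Δt ≤ T → ∀ un : EuclideanSpace ℝ (Fin d), ‖un‖ ≤ R →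
      ∀ mstar, 1 ≤ mstar → mstar ≤ M →
      ‖(hybridSub d c A S f Δt ((n : ℝ) * Δt) (((n : ℝ) + 1) * Δt) un mstar).1
          - (un - Δt • ∑ m ∈ Finset.Icc 1 mstar, ∑ k ∈ Finset.Icc 1 (c m),
              (((∑ s ∈ Finset.Icc 1 (c (m - 1)),
                    matApp (A m k s ((n : ℝ) * Δt)) un)
                  + matApp (S m k (((n : ℝ) + 1) * Δt)) un)
                + f m k ((n : ℝ) * Δt)))‖ ≤ C * Δt ^ 2 := by
  have hbound : ∀ᶠ B : ℝ in Filter.atTop,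
      (∀ m ∈ Finset.Icc 1 M, ∀ k ∈ Finset.Icc 1 (c m), ∀ s ∈ Finset.Icc 1 (c (m - 1)),
        ∀ t ∈ Set.Icc 0 T, ‖Matrix.toEuclideanCLM (𝕜 := ℝ) (A m k s t)‖ ≤ B) ∧
      (∀ m ∈ Finset.Icc 1 M, ∀ k ∈ Finset.Icc 1 (c m),
        ∀ t ∈ Set.Icc 0 T, ‖Matrix.toEuclideanCLM (𝕜 := ℝ) (S m k t)‖ ≤ B) ∧
      (∀ m ∈ Finset.Icc 1 M, ∀ k ∈ Finset.Icc 1 (c m),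
        ∀ t ∈ Set.Icc 0 T, ‖f m k t‖ ≤ B) := by
    simp only [Filter.eventually_and, Filter.eventually_all_finset]
    exact ⟨fun m hm k hk s hs => (hA_lip m hm k hk s hs).eventually_norm_le,
      fun m hm k hk => (hS_lip m hm k hk).eventually_norm_le,
      fun m hm k hk => (hf_lip m hm k hk).eventually_norm_le⟩
  obtain ⟨B, ⟨hA, hS, hf⟩, hB⟩ := (hbound.and (Filter.eventually_ge_atTop 0)).exists
  have huniform : ∀ᶠ C : ℝ in Filter.atTop, ∀ mstar ∈ Finset.Icc 1 M,
      ∀ Δt : ℝ, 0 < Δt → Δt ≤ 1 → ∀ n : ℕ,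
      ((n : ℝ) + 1) * Δt ≤ T → ∀ un : EuclideanSpace ℝ (Fin d), ‖un‖ ≤ R →
      ‖(hybridSub d c A S f Δt ((n : ℝ) * Δt) (((n : ℝ) + 1) * Δt) un mstar).1
          - (un - Δt • ∑ m ∈ Finset.Icc 1 mstar, ∑ k ∈ Finset.Icc 1 (c m),
              (((∑ s ∈ Finset.Icc 1 (c (m - 1)),
                    matApp (A m k s ((n : ℝ) * Δt)) un)
                  + matApp (S m k (((n : ℝ) + 1) * Δt)) un)
                + f m k ((n : ℝ) * Δt)))‖ ≤ C * Δt ^ 2 := by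
    rw [Filter.eventually_all_finset]
    intro mstar hmstar
    have hsub : Finset.Icc 1 mstar ⊆ Finset.Icc 1 M :=
      Finset.Icc_subset_Icc_right (Finset.mem_Icc.mp hmstar).2
    obtain ⟨C₀, -, hC₀⟩ := exists_hybridSub_expansion_bound d c hB hR.le mstar fun j hj =>
      hc j (Finset.mem_Icc.mp (hsub hj)).1 (Finset.mem_Icc.mp (hsub hj)).2
    filter_upwards [Filter.eventually_ge_atTop C₀] with C hC Δt hΔ hΔ1 n hn un hun
    have htn1 : ((n : ℝ) + 1) * Δt ∈ Set.Icc 0 T := ⟨by positivity, hn⟩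
    have htn : (n : ℝ) * Δt ∈ Set.Icc 0 T := ⟨by positivity, by linarith⟩
    refine ((hC₀ A S f Δt _ _ hΔ.le hΔ1
      (fun j hj k hk s hs => hA j (hsub hj) k hk s hs _ htn)
      (fun j hj k hk => hS j (hsub hj) k hk _ htn1)
      (fun j hj k hk => hS_pd j (hsub hj) k hk _ htn1)
      (fun j hj k hk => hf j (hsub hj) k hk _ htn) un hun).1).trans ?_
    gcongr
  obtain ⟨C, hC, hCpos⟩ := (huniform.and (Filter.eventually_gt_atTop 0)).exists
  exact ⟨C, hCpos, 1, one_pos, fun Δt hΔ hΔ1 n hn un hun mstar h1 hM' =>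
    hC mstar (Finset.mem_Icc.mpr ⟨h1, hM'⟩) Δt hΔ hΔ1 n hn un hun⟩
end

section
/- Let Ω ⊂ ℝ² have finite positive Lebesgue measure, let g : Ω → ℝ be bounded measurable, let ε > 0, η ≥ 0 and σ > 0. Define E(v) = ∫_Ω v g dx + ε ∫_Ω ( v ln v + (1−v) ln(1−v) ) dx + η ∫_Ω v(x) (G_σ * (1_Ω − v))(x) dx on the set { v : Ω → ℝ measurable, 0 ≤ v ≤ 1 a.e. }, with v extended by zero outside Ω in the convolution and with the convention 0·ln 0 = 0. If u minimizes E over this set, then 0 < u(x) < 1 for a.e. x ∈ Ω and u satisfies the Euler–Lagrange equation ε·ln( u/(1−u) ) + η·(G_σ * (1_Ω − 2u)) + g = 0 a.e. on Ω. -/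
open MeasureTheory

/-- The two-phase regularized Potts energy
`E(v) = ∫_Ω v g + ε ∫_Ω (v ln v + (1−v) ln(1−v)) + η ∫_Ω v (G_σ*(1_Ω − v))`,
with `v` extended by zero outside `Ω` in the convolution.  (Note that `Real.log 0 = 0` in
Mathlib, which implements the convention `0·ln 0 = 0`.) -/
noncomputable def twoPhaseE (Ω : Set Plane) (g : Plane → ℝ) (ε η σ : ℝ)
    (v : Plane → ℝ) : ℝ :=
  (∫ x in Ω, v x * g x)
    + ε * (∫ x in Ω, (v x * Real.log (v x) + (1 - v x) * Real.log (1 - v x)))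
    + η * ∫ x in Ω, v x * gaussConv σ (Ω.indicator fun z => 1 - v z) x

open InformationTheory in
/-- Gibbs' inequality for Bernoulli distributions, with its equality case. -/
lemma eq_of_bernoulli_relative_entropy_nonpos {s w : ℝ} (hs0 : 0 ≤ s) (hs1 : s ≤ 1)
    (hw0 : 0 < w) (hw1 : w < 1)
    (h : -Real.binEntropy s ≤ s * Real.log w + (1 - s) * Real.log (1 - w)) : s = w := by
  have hw1' : 0 < 1 - w := by linarith
  have key : ∀ a b : ℝ, 0 < b →
      b * klFun (a / b) = a * Real.log a - a * Real.log b + b - a := by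
    intro a b hb
    rcases eq_or_ne a 0 with rfl | ha
    · simp [klFun]
    · rw [klFun, Real.log_div ha hb.ne']
      field_simp
  have e1 := key s w hw0
  have e2 := key (1 - s) (1 - w) hw1'
  have n1 : 0 ≤ klFun (s / w) := klFun_nonneg (by positivity)
  have n2 : 0 ≤ klFun ((1 - s) / (1 - w)) := klFun_nonneg (div_nonneg (by linarith) hw1'.le)
  rw [Real.binEntropy_eq_negMulLog_add_negMulLog_one_sub, Real.negMulLog, Real.negMulLog] at h
  have m1 : 0 ≤ w * klFun (s / w) := by positivity
  have m2 : 0 ≤ (1 - w) * klFun ((1 - s) / (1 - w)) := by positivity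
  have hz : w * klFun (s / w) = 0 := by linarith
  have hz' : klFun (s / w) = 0 := by simpa [hw0.ne'] using hz
  rw [klFun_eq_zero_iff (by positivity), div_eq_one_iff_eq hw0.ne'] at hz'
  exact hz'

/-- The Gibbs variational principle on two states: the logistic function minimizes
`s ↦ p s - ε H(s)`, where `H` is the binary entropy. -/
lemma logistic_free_energy_le {ε p s : ℝ} (hε : 0 < ε) (hs0 : 0 ≤ s) (hs1 : s ≤ 1) :
    let w := (1 + Real.exp (p / ε))⁻¹
    0 < w ∧ w < 1 ∧ ε * Real.log (w / (1 - w)) + p = 0 ∧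
      p * w - ε * Real.binEntropy w ≤ p * s - ε * Real.binEntropy s ∧
      (p * s - ε * Real.binEntropy s ≤ p * w - ε * Real.binEntropy w → s = w) := by
  intro w
  have he := Real.exp_pos (p / ε)
  have hw0 : 0 < w := by positivity
  have hw1 : w < 1 := inv_lt_one_of_one_lt₀ (by linarith)
  have hw1' : 0 < 1 - w := by linarith
  have hodds : w / (1 - w) = Real.exp (-(p / ε)) := by
    have hne : 1 + Real.exp (p / ε) ≠ 0 := by positivity
    rw [Real.exp_neg, div_eq_iff hw1'.ne']
    simp only [w]
    field_simp
    ring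
  have hlog : Real.log (w / (1 - w)) = -(p / ε) := by rw [hodds, Real.log_exp]
  have hEL : ε * Real.log (w / (1 - w)) + p = 0 := by
    rw [hlog]; field_simp; ring
  have hp : p = ε * (Real.log (1 - w) - Real.log w) := by
    rw [Real.log_div hw0.ne' hw1'.ne'] at hEL; linarith
  have hHw : Real.binEntropy w = -(w * Real.log w) - (1 - w) * Real.log (1 - w) := by
    rw [Real.binEntropy_eq_negMulLog_add_negMulLog_one_sub, Real.negMulLog, Real.negMulLog]; ring
  have hdiff : (p * s - ε * Real.binEntropy s) - (p * w - ε * Real.binEntropy w) =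
      ε * (-Real.binEntropy s - (s * Real.log w + (1 - s) * Real.log (1 - w))) := by
    rw [hHw, hp]; ring
  have huniq : p * s - ε * Real.binEntropy s ≤ p * w - ε * Real.binEntropy w → s = w := by
    intro h
    refine eq_of_bernoulli_relative_entropy_nonpos hs0 hs1 hw0 hw1 ?_
    by_contra! hlt
    have := mul_pos hε (sub_pos.2 hlt)
    linarith
  refine ⟨hw0, hw1, hEL, ?_, huniq⟩
  by_contra! hlt
  rw [huniq hlt.le] at hlt
  exact lt_irrefl _ hlt

section Kernel

variable {X : Type*} [MeasurableSpace X] {μ : Measure X}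
  {k : X → X → ℝ} {C : ℝ} {f h : X → ℝ}

lemma integrable_kernel_prod [SFinite μ] (hk : Measurable (Function.uncurry k)) (hC : ∀ x y, |k x y| ≤ C)
    (hf : Integrable f μ) (hh : Integrable h μ) :
    Integrable (fun z : X × X => f z.1 * (k z.1 z.2 * h z.2)) (μ.prod μ) := by
  have := (hf.mul_prod hh).bdd_mul (c := C) hk.aestronglyMeasurable
    (Filter.Eventually.of_forall fun z => hC z.1 z.2)
  refine this.congr (Filter.Eventually.of_forall fun z => ?_)
  simp only [Function.uncurry]
  ring

lemma integrable_kernel (hk : Measurable (Function.uncurry k)) (hC : ∀ x y, |k x y| ≤ C)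
    (hh : Integrable h μ) (x : X) : Integrable (fun y => k x y * h y) μ :=
  hh.bdd_mul (c := C) (hk.comp measurable_prodMk_left).aestronglyMeasurable
    (Filter.Eventually.of_forall fun y => hC x y)

lemma integrable_mul_integral_kernel [SFinite μ] (hk : Measurable (Function.uncurry k))
    (hC : ∀ x y, |k x y| ≤ C) (hf : Integrable f μ) (hh : Integrable h μ) :
    Integrable (fun x => f x * ∫ y, k x y * h y ∂μ) μ := by
  have := (integrable_kernel_prod hk hC hf hh).integral_prod_left
  simpa only [integral_const_mul] using this

lemma integral_mul_integral_kernel_comm [SFinite μ] (hk : Measurable (Function.uncurry k))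
    (hC : ∀ x y, |k x y| ≤ C) (hsymm : ∀ x y, k x y = k y x)
    (hf : Integrable f μ) (hh : Integrable h μ) :
    ∫ x, f x * ∫ y, k x y * h y ∂μ ∂μ = ∫ x, h x * ∫ y, k x y * f y ∂μ ∂μ := by
  simp only [← integral_const_mul]
  rw [integral_integral_swap (f := fun x y => f x * (k x y * h y))
    (integrable_kernel_prod hk hC hf hh)]
  refine integral_congr_ae (.of_forall fun x => integral_congr_ae (.of_forall fun y => ?_))
  simp only [hsymm y x]
  ring

/-- Second-order expansion of `v ↦ ∫ v K(1 - v)` along a segment. -/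
lemma integral_kernel_interaction_add_smul [IsFiniteMeasure μ]
    (hk : Measurable (Function.uncurry k)) (hC : ∀ x y, |k x y| ≤ C) (hsymm : ∀ x y, k x y = k y x)
    (hf : Integrable f μ) (hh : Integrable h μ) (t : ℝ) :
    ∫ x, (f x + t * h x) * ∫ y, k x y * (1 - (f y + t * h y)) ∂μ ∂μ =
      ∫ x, f x * ∫ y, k x y * (1 - f y) ∂μ ∂μ
        + t * ∫ x, h x * ∫ y, k x y * (1 - 2 * f y) ∂μ ∂μ
        - t ^ 2 * ∫ x, h x * ∫ y, k x y * h y ∂μ ∂μ := by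
  have h1 : Integrable (fun x => 1 - f x) μ := (integrable_const 1).sub hf
  have hsub : ∀ x, ∫ y, k x y * (1 - (f y + t * h y)) ∂μ =
      ∫ y, k x y * (1 - f y) ∂μ - t * ∫ y, k x y * h y ∂μ := by
    intro x
    rw [← integral_const_mul, ← integral_sub (integrable_kernel hk hC h1 x)
      ((integrable_kernel hk hC hh x).const_mul t)]
    congr 1 with y
    ring
  have hsub' : ∀ x, ∫ y, k x y * (1 - 2 * f y) ∂μ =
      ∫ y, k x y * (1 - f y) ∂μ - ∫ y, k x y * f y ∂μ := by
    intro x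
    rw [← integral_sub (integrable_kernel hk hC h1 x) (integrable_kernel hk hC hf x)]
    congr 1 with y
    ring
  have i1 := integrable_mul_integral_kernel hk hC hf h1
  have i2 := integrable_mul_integral_kernel hk hC hh h1
  have i3 := integrable_mul_integral_kernel hk hC hf hh
  have i4 := integrable_mul_integral_kernel hk hC hh hh
  have i5 := integrable_mul_integral_kernel hk hC hh hf
  have e1 : ∫ x, h x * ∫ y, k x y * (1 - 2 * f y) ∂μ ∂μ =
      ∫ x, h x * ∫ y, k x y * (1 - f y) ∂μ ∂μ - ∫ x, f x * ∫ y, k x y * h y ∂μ ∂μ := by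
    rw [integral_mul_integral_kernel_comm hk hC hsymm hf hh, ← integral_sub i2 i5]
    congr 1 with x
    rw [hsub']
    ring
  have i23 : Integrable (fun x => t * (h x * ∫ y, k x y * (1 - f y) ∂μ
      - f x * ∫ y, k x y * h y ∂μ)) μ := (i2.sub i3).const_mul t
  have i123 : Integrable (fun x => f x * ∫ y, k x y * (1 - f y) ∂μ
      + t * (h x * ∫ y, k x y * (1 - f y) ∂μ - f x * ∫ y, k x y * h y ∂μ)) μ := i1.add i23
  rw [e1, ← integral_sub i2 i3, ← integral_const_mul, ← integral_const_mul,
    ← integral_add i1 i23, ← integral_sub i123 (i4.const_mul _)]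
  congr 1 with x
  rw [hsub]
  ring

end Kernel

lemma gaussConv_indicator {Ω : Set Plane} (hΩ : MeasurableSet Ω) (σ : ℝ) (f : Plane → ℝ)
    (x : Plane) :
    gaussConv σ (Ω.indicator f) x = ∫ y in Ω, gaussKer σ (x - y) * f y := by
  rw [gaussConv, ← integral_indicator hΩ]
  congr 1 with y
  simp only [Set.indicator]
  split_ifs <;> simp

lemma measurable_gaussKer_sub (σ : ℝ) :
    Measurable (Function.uncurry fun x y : Plane => gaussKer σ (x - y)) := by
  unfold gaussKer Function.uncurry
  fun_prop

lemma abs_gaussKer_le (σ : ℝ) (x : Plane) : |gaussKer σ x| ≤ 1 / (2 * Real.pi * σ ^ 2) := by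
  have h : Real.exp (-‖x‖ ^ 2 / (2 * σ ^ 2)) ≤ 1 := by
    rw [Real.exp_le_one_iff]
    exact div_nonpos_of_nonpos_of_nonneg (by nlinarith [norm_nonneg x]) (by positivity)
  rw [gaussKer, abs_of_nonneg (by positivity)]
  exact mul_le_of_le_one_right (by positivity) h

lemma gaussKer_sub_comm (σ : ℝ) (x y : Plane) : gaussKer σ (x - y) = gaussKer σ (y - x) := by
  rw [gaussKer, gaussKer, norm_sub_rev]

lemma integrable_of_ae_mem_unitInterval {X : Type*} [MeasurableSpace X] {μ : Measure X}
    [IsFiniteMeasure μ] {v : X → ℝ} (hv : Measurable v)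
    (h : ∀ᵐ x ∂μ, 0 ≤ v x ∧ v x ≤ 1) : Integrable v μ :=
  .of_bound hv.aestronglyMeasurable 1 <| h.mono fun x hx => by
    rw [Real.norm_eq_abs, abs_of_nonneg hx.1]; exact hx.2

lemma integrable_binEntropy_comp {X : Type*} [MeasurableSpace X] {μ : Measure X}
    [IsFiniteMeasure μ] {v : X → ℝ} (hv : Measurable v)
    (h : ∀ᵐ x ∂μ, 0 ≤ v x ∧ v x ≤ 1) : Integrable (fun x => Real.binEntropy (v x)) μ :=
  .of_bound (Real.binEntropy_continuous.measurable.comp hv).aestronglyMeasurable (Real.log 2) <|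
    h.mono fun x hx => by
      rw [Real.norm_eq_abs, abs_of_nonneg (Real.binEntropy_nonneg hx.1 hx.2)]
      exact Real.binEntropy_le_log_two

lemma twoPhaseE_eq {Ω : Set Plane} (hΩ : MeasurableSet Ω) (g : Plane → ℝ) (ε η σ : ℝ)
    (v : Plane → ℝ) :
    twoPhaseE Ω g ε η σ v = (∫ x in Ω, v x * g x) - ε * (∫ x in Ω, Real.binEntropy (v x))
      + η * ∫ x in Ω, v x * ∫ y in Ω, gaussKer σ (x - y) * (1 - v y) := by
  have h : ∀ s : ℝ, s * Real.log s + (1 - s) * Real.log (1 - s) = -Real.binEntropy s := by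
    intro s
    rw [Real.binEntropy_eq_negMulLog_add_negMulLog_one_sub, Real.negMulLog, Real.negMulLog]
    ring
  simp only [twoPhaseE, gaussConv_indicator hΩ, h, integral_neg]
  ring

/-- **Interior minimizers and the Euler–Lagrange equation for the two-phase Potts model
(equation (\ref{eq.Potts.EL})).**  If `u` minimizes `E` over all measurable `v : Ω → [0,1]`,
then `0 < u < 1` a.e. on `Ω` and `ε ln(u/(1−u)) + η G_σ*(1_Ω − 2u) + g = 0` a.e. on `Ω`. -/
theorem twoPhase_minimizer_euler_lagrange
    (Ω : Set Plane) (hΩ : MeasurableSet Ω)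
    (hΩ0 : 0 < volume Ω) (hΩfin : volume Ω < ⊤)
    (g : Plane → ℝ) (hg_meas : Measurable g) (Cg : ℝ) (hg_bd : ∀ x ∈ Ω, |g x| ≤ Cg)
    (ε η σ : ℝ) (hε : 0 < ε) (hη : 0 ≤ η) (hσ : 0 < σ)
    (u : Plane → ℝ) (hu_meas : Measurable u)
    (hu_range : ∀ᵐ x ∂(volume.restrict Ω), 0 ≤ u x ∧ u x ≤ 1)
    (hmin : ∀ v : Plane → ℝ, Measurable v →
      (∀ᵐ x ∂(volume.restrict Ω), 0 ≤ v x ∧ v x ≤ 1) →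
      twoPhaseE Ω g ε η σ u ≤ twoPhaseE Ω g ε η σ v) :
    ∀ᵐ x ∂(volume.restrict Ω),
      (0 < u x ∧ u x < 1) ∧
        ε * Real.log (u x / (1 - u x))
            + η * gaussConv σ (Ω.indicator fun z => 1 - 2 * u z) x + g x = 0 := by
  have : IsFiniteMeasure (volume.restrict Ω) := ⟨by simpa using hΩfin⟩
  set μ : Measure Plane := volume.restrict Ω with hμ
  have hk := measurable_gaussKer_sub σ
  have hC : ∀ x y : Plane, |gaussKer σ (x - y)| ≤ 1 / (2 * Real.pi * σ ^ 2) :=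
    fun x y => abs_gaussKer_le σ (x - y)
  have hsymm := gaussKer_sub_comm σ
  have hg : Integrable g μ := .of_bound hg_meas.aestronglyMeasurable Cg <|
    (ae_restrict_iff' hΩ).2 (.of_forall fun x hx => hg_bd x hx)
  set Ku : Plane → ℝ := fun x => ∫ y, gaussKer σ (x - y) * (1 - 2 * u y) ∂μ
  have hKu_meas : Measurable Ku := by
    refine StronglyMeasurable.measurable (StronglyMeasurable.integral_prod_right'
      (f := fun z : Plane × Plane => gaussKer σ (z.1 - z.2) * (1 - 2 * u z.2)) ?_)
    refine Measurable.stronglyMeasurable (Measurable.mul hk ?_)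
    fun_prop
  set p : Plane → ℝ := fun x => η * Ku x + g x with hp
  have hp_meas : Measurable p := (hKu_meas.const_mul η).add hg_meas
  set w : Plane → ℝ := fun x => (1 + Real.exp (p x / ε))⁻¹
  have hw_meas : Measurable w := by fun_prop
  have hw_spec := fun x {s : ℝ} => logistic_free_energy_le (p := p x) (s := s) hε
  have hw_range : ∀ x, 0 ≤ w x ∧ w x ≤ 1 := fun x =>
    ⟨(hw_spec x le_rfl zero_le_one).1.le, (hw_spec x le_rfl zero_le_one).2.1.le⟩
  have hu_int := integrable_of_ae_mem_unitInterval hu_meas hu_range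
  have hw_int := integrable_of_ae_mem_unitInterval (μ := μ) hw_meas (.of_forall hw_range)
  have hHu := integrable_binEntropy_comp hu_meas hu_range
  have hHw := integrable_binEntropy_comp (μ := μ) hw_meas (.of_forall hw_range)
  set d : Plane → ℝ := fun x => w x - u x with hd
  have hd_int : Integrable d μ := hw_int.sub hu_int
  have hd_bd : ∀ᵐ x ∂μ, ‖d x‖ ≤ 1 := hu_range.mono fun x hx => by
    rw [Real.norm_eq_abs, abs_le]
    constructor <;> simp only [hd] <;> linarith [hw_range x]
  have hdg : Integrable (fun x => d x * g x) μ :=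
    hg.bdd_mul hd_int.aestronglyMeasurable hd_bd
  have hug : Integrable (fun x => u x * g x) μ :=
    hg.bdd_mul (c := 1) hu_meas.aestronglyMeasurable <| hu_range.mono fun x hx => by
      rw [Real.norm_eq_abs, abs_of_nonneg hx.1]; exact hx.2
  have hdK : Integrable (fun x => d x * Ku x) μ :=
    integrable_mul_integral_kernel hk hC hd_int ((integrable_const 1).sub (hu_int.const_mul 2))
  set B : ℝ := ∫ x, d x * ∫ y, gaussKer σ (x - y) * d y ∂μ ∂μ
  set A : ℝ := (∫ x, d x * g x ∂μ)
    - ε * ((∫ x, Real.binEntropy (w x) ∂μ) - ∫ x, Real.binEntropy (u x) ∂μ)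
    + η * ∫ x, d x * Ku x ∂μ
  have hstep : ∀ t ∈ Set.Ioo (0 : ℝ) 1, t * (η * B) ≤ A := by
    intro t ⟨ht0, ht1⟩
    have hv_range : ∀ᵐ x ∂μ, 0 ≤ u x + t * d x ∧ u x + t * d x ≤ 1 :=
      hu_range.mono fun x hx => by
        have := hw_range x
        constructor <;> simp only [hd] <;> nlinarith
    have hv_meas : Measurable fun x => u x + t * d x := by fun_prop
    have hle := hmin _ hv_meas hv_range
    rw [twoPhaseE_eq hΩ, twoPhaseE_eq hΩ, ← hμ,
      integral_kernel_interaction_add_smul hk hC hsymm hu_int hd_int t] at hle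
    have hlin : ∫ x, (u x + t * d x) * g x ∂μ
        = (∫ x, u x * g x ∂μ) + t * ∫ x, d x * g x ∂μ := by
      rw [← integral_const_mul, ← integral_add hug (hdg.const_mul t)]
      congr 1 with x
      ring
    have hent : (1 - t) * (∫ x, Real.binEntropy (u x) ∂μ) + t * (∫ x, Real.binEntropy (w x) ∂μ)
        ≤ ∫ x, Real.binEntropy (u x + t * d x) ∂μ := by
      rw [← integral_const_mul, ← integral_const_mul,
        ← integral_add (hHu.const_mul _) (hHw.const_mul _)]
      refine integral_mono_ae ((hHu.const_mul _).add (hHw.const_mul _))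
        (integrable_binEntropy_comp hv_meas hv_range) (hu_range.mono fun x hx => ?_)
      have := Real.strictConcave_binEntropy.concaveOn.2 hx (hw_range x)
        (sub_nonneg.2 ht1.le) ht0.le (by ring)
      simp only [smul_eq_mul] at this
      have e : u x + t * d x = (1 - t) * u x + t * w x := by simp only [hd]; ring
      simp only [e]
      exact this
    rw [hlin] at hle
    have hent' := mul_le_mul_of_nonneg_left hent hε.le
    refine le_of_mul_le_mul_left ?_ ht0
    linear_combination hle + hent'
  have hA0 : 0 ≤ A := by
    have hlim : Filter.Tendsto (fun t : ℝ => t * (η * B)) (nhdsWithin 0 (Set.Ioi 0)) (nhds 0) := by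
      have : Continuous fun t : ℝ => t * (η * B) := by fun_prop
      simpa using (this.tendsto 0).mono_left nhdsWithin_le_nhds
    exact le_of_tendsto hlim
      (Filter.mem_of_superset (Ioo_mem_nhdsGT zero_lt_one) fun t ht => hstep t ht)
  set D : Plane → ℝ := fun x => (p x * u x - ε * Real.binEntropy (u x))
    - (p x * w x - ε * Real.binEntropy (w x)) with hD
  have hD_eq : D = fun x => -(d x * g x)
      + ε * (Real.binEntropy (w x) - Real.binEntropy (u x)) - η * (d x * Ku x) := by
    funext x
    simp only [hD, hp, hd]
    ring
  have hdg_neg : Integrable (fun x => -(d x * g x)) μ := hdg.neg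
  have hH_int : Integrable
      (fun x => ε * (Real.binEntropy (w x) - Real.binEntropy (u x))) μ :=
    (hHw.sub hHu).const_mul ε
  have hsum_int : Integrable (fun x => -(d x * g x)
      + ε * (Real.binEntropy (w x) - Real.binEntropy (u x))) μ := hdg_neg.add hH_int
  have hD_int : Integrable D μ := by
    rw [hD_eq]
    exact hsum_int.sub (hdK.const_mul η)
  have hD_integral : ∫ x, D x ∂μ = -A := by
    rw [hD_eq, integral_sub hsum_int (hdK.const_mul η),
      integral_add hdg_neg hH_int, integral_neg, integral_const_mul,
      integral_const_mul, integral_sub hHw hHu]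
    ring
  have hD_nonneg : 0 ≤ᵐ[μ] D := hu_range.mono fun x hx =>
    sub_nonneg.2 (hw_spec x hx.1 hx.2).2.2.2.1
  have hD_zero : D =ᵐ[μ] 0 := (integral_eq_zero_iff_of_nonneg_ae hD_nonneg hD_int).1 <|
    le_antisymm (by linarith) (integral_nonneg_of_ae hD_nonneg)
  filter_upwards [hu_range, hD_zero] with x hx hDx
  obtain ⟨h0, h1, hEL, -, huniq⟩ := hw_spec x hx.1 hx.2
  have huw : u x = w x := huniq (sub_eq_zero.1 hDx).le
  rw [gaussConv_indicator hΩ, huw, add_assoc]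
  exact ⟨⟨h0, h1⟩, hEL⟩
end
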